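/- Assume d ≥ 3, Ω is irreducible, and the torsion-free group Γ divides Ω. Then every flat of Ω is a boundary flat, and there are finitely many flats F₁,…,F_k of Ω such that every flat of Ω equals γ̄(Fⱼ) for some γ ∈ Γ and some j ∈ {1,…,k}; that is, the set of flats of Ω consists of finitely many Γ-orbits. -/

import Mathlib

open Set Filter Metric

noncomputable section

/-- `ℝ^d`. -/
abbrev Euc (d : ℕ) := EuclideanSpace ℝ (Fin d)

/-- A flat of `Ω` with prescribed vertices `v`. -/
def IsFlatWith {d : ℕ} (Ω : Set (Euc d)) (v : Fin d → Euc d) : Prop :=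
  AffineIndependent ℝ v ∧
  (∀ j, v j ∈ closure Ω \ Ω) ∧
  intrinsicInterior ℝ (convexHull ℝ (Set.range v)) ⊆ Ω ∧
  convexHull ℝ (Set.range v) \ intrinsicInterior ℝ (convexHull ℝ (Set.range v)) ⊆ closure Ω \ Ω

/-- A (codimension-one, properly embedded) flat of `Ω`. -/
def IsFlat {d : ℕ} (Ω : Set (Euc d)) (F : Set (Euc d)) : Prop :=
  ∃ v : Fin d → Euc d, IsFlatWith Ω v ∧ F = intrinsicInterior ℝ (convexHull ℝ (Set.range v))

/-- The cone over a subset of `ℝ^d`, inside `ℝ^d × ℝ ≅ ℝ^{d+1}`. -/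
def coneOver {d : ℕ} (S : Set (Euc d)) : Set (Euc d × ℝ) :=
  {p | ∃ t : ℝ, 0 < t ∧ ∃ x ∈ S, p = t • (x, (1 : ℝ))}

/-- Irreducibility of a properly convex domain: its cone admits no direct-sum
decomposition into convex cones. -/
def IsIrreducibleDomain {d : ℕ} (Ω : Set (Euc d)) : Prop :=
  ¬ ∃ (V₁ V₂ : Submodule ℝ (Euc d × ℝ)) (C₁ C₂ : Set (Euc d × ℝ)),
      V₁ ≠ ⊥ ∧ V₂ ≠ ⊥ ∧ V₁ ≠ ⊤ ∧ V₂ ≠ ⊤ ∧ IsCompl V₁ V₂ ∧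
      C₁ ⊆ (V₁ : Set (Euc d × ℝ)) ∧ C₂ ⊆ (V₂ : Set (Euc d × ℝ)) ∧
      Convex ℝ C₁ ∧ Convex ℝ C₂ ∧
      (∀ t : ℝ, 0 < t → ∀ c ∈ C₁, t • c ∈ C₁) ∧
      (∀ t : ℝ, 0 < t → ∀ c ∈ C₂, t • c ∈ C₂) ∧
      coneOver Ω = {p | ∃ c₁ ∈ C₁, ∃ c₂ ∈ C₂, p = c₁ + c₂}

/-- The homeomorphism of `Ω` induced by a linear automorphism of `ℝ^{d+1}`
preserving the cone over `Ω`. -/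
def projAct {d : ℕ} (g : (Euc d × ℝ) ≃ₗ[ℝ] (Euc d × ℝ)) (x : Euc d) : Euc d :=
  ((g (x, 1)).2)⁻¹ • (g (x, 1)).1

/-- `Γ` divides `Ω`: every element preserves the cone over `Ω`; the induced action on `Ω`
is free and properly discontinuous, and admits a compact set whose translates cover `Ω`. -/
def Divides {d : ℕ} (Ω : Set (Euc d))
    (Γ : Subgroup ((Euc d × ℝ) ≃ₗ[ℝ] (Euc d × ℝ))) : Prop :=
  (∀ γ ∈ Γ, (γ : (Euc d × ℝ) ≃ₗ[ℝ] (Euc d × ℝ)) '' coneOver Ω = coneOver Ω) ∧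
  (∀ γ ∈ Γ, γ ≠ 1 → ∀ x ∈ Ω, projAct γ x ≠ x) ∧
  (∀ K : Set (Euc d), K ⊆ Ω → IsCompact K →
    {γ : (Euc d × ℝ) ≃ₗ[ℝ] (Euc d × ℝ) | γ ∈ Γ ∧ (projAct γ '' K ∩ K).Nonempty}.Finite) ∧
  (∃ K : Set (Euc d), K ⊆ Ω ∧ IsCompact K ∧ (⋃ γ ∈ Γ, projAct γ '' K) = Ω)

/-- `Γ` is torsion-free. -/
def TorsionFreeSub {d : ℕ} (Γ : Subgroup ((Euc d × ℝ) ≃ₗ[ℝ] (Euc d × ℝ))) : Prop :=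
  ∀ γ ∈ Γ, ∀ n : ℕ, n ≠ 0 → γ ^ n = 1 → γ = 1

/-- Convergence of a sequence of flats: Hausdorff convergence of their closures. -/
def FlatsConverge {d : ℕ} (Fs : ℕ → Set (Euc d)) (F : Set (Euc d)) : Prop :=
  Tendsto (fun i => hausdorffDist (closure (Fs i)) (closure F)) atTop (nhds 0)

/-- A flat is isolated if no sequence of flats, all distinct from it, converges to it. -/
def IsIsolatedFlat {d : ℕ} (Ω F : Set (Euc d)) : Prop :=
  ¬ ∃ Fs : ℕ → Set (Euc d), (∀ i, IsFlat Ω (Fs i)) ∧ (∀ i, Fs i ≠ F) ∧ FlatsConverge Fs F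

/-- The union of all flats of `Ω`. -/
def flatsUnion {d : ℕ} (Ω : Set (Euc d)) : Set (Euc d) := ⋃₀ {F | IsFlat Ω F}

/-- A boundary flat: a flat contained in the closure of a connected component of the
complement of the union of all flats. -/
def IsBoundaryFlat {d : ℕ} (Ω F : Set (Euc d)) : Prop :=
  IsFlat Ω F ∧ ∃ x ∈ Ω \ flatsUnion Ω,
    F ⊆ closure (connectedComponentIn (Ω \ flatsUnion Ω) x)

open scoped Topology

section Cone

variable {E : Type*} [NormedAddCommGroup E] [NormedSpace ℝ E]

/-- A nonempty open convex cone on which some continuous functional dominates the norm. -/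
structure IsSalientCone (C : Set E) : Prop where
  isOpen : IsOpen C
  convex : Convex ℝ C
  nonempty : C.Nonempty
  smul_mem : ∀ t : ℝ, 0 < t → ∀ x ∈ C, t • x ∈ C
  salient : ∃ ℓ : E →L[ℝ] ℝ, ∀ x ∈ C, ‖x‖ ≤ ℓ x

namespace IsSalientCone

variable {C : Set E}

theorem smul_mem_closure (hC : IsSalientCone C) {t : ℝ} (ht : 0 ≤ t) {x : E}
    (hx : x ∈ closure C) : t • x ∈ closure C := by
  have hpos : ∀ s : ℝ, 0 < s → s • x ∈ closure C := fun s hs =>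
    map_mem_closure (continuous_const_smul s) hx (fun y hy => hC.smul_mem s hs y hy)
  rcases ht.lt_or_eq with h | h
  · exact hpos t h
  · subst h
    have hlim : Tendsto (fun s : ℝ => s • x) (𝓝[>] 0) (𝓝 ((0 : ℝ) • x)) :=
      ((continuous_id.smul continuous_const).tendsto (0 : ℝ)).mono_left nhdsWithin_le_nhds
    exact isClosed_closure.mem_of_tendsto hlim
      (eventually_nhdsWithin_of_forall fun s hs => hpos s hs)

theorem zero_mem_closure (hC : IsSalientCone C) : (0 : E) ∈ closure C := by
  obtain ⟨x, hx⟩ := hC.nonempty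
  simpa using hC.smul_mem_closure le_rfl (subset_closure hx)

theorem add_mem_closure (hC : IsSalientCone C) {x y : E} (hx : x ∈ closure C)
    (hy : y ∈ closure C) : x + y ∈ closure C := by
  have h := hC.convex.closure hx hy (by norm_num : (0 : ℝ) ≤ 1 / 2)
    (by norm_num : (0 : ℝ) ≤ 1 / 2) (by norm_num)
  have h2 := hC.smul_mem_closure (by norm_num : (0 : ℝ) ≤ 2) h
  simpa [smul_add, smul_smul] using h2

theorem add_mem (hC : IsSalientCone C) {x y : E} (hx : x ∈ C) (hy : y ∈ closure C) :
    x + y ∈ C := by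
  have h := hC.convex.combo_interior_closure_mem_interior (x := x) (y := y)
    (by rwa [hC.isOpen.interior_eq]) hy (by norm_num : (0 : ℝ) < 1 / 2)
    (by norm_num : (0 : ℝ) ≤ 1 / 2) (by norm_num)
  rw [hC.isOpen.interior_eq] at h
  have h2 := hC.smul_mem 2 (by norm_num) _ h
  simpa [smul_add, smul_smul] using h2

theorem sum_mem_closure (hC : IsSalientCone C) {ι : Type*} (s : Finset ι) {f : ι → E}
    (hf : ∀ i ∈ s, f i ∈ closure C) : ∑ i ∈ s, f i ∈ closure C := by
  classical
  induction s using Finset.induction_on with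
  | empty => simpa using hC.zero_mem_closure
  | insert a s ha ih =>
    rw [Finset.sum_insert ha]
    exact hC.add_mem_closure (hf a (Finset.mem_insert_self a s))
      (ih fun i hi => hf i (Finset.mem_insert_of_mem hi))

theorem interior_closure (hC : IsSalientCone C) : interior (closure C) = C := by
  rw [hC.convex.interior_closure_eq_interior_of_nonempty_interior, hC.isOpen.interior_eq]
  rw [hC.isOpen.interior_eq]
  exact hC.nonempty

theorem exists_norm_le (hC : IsSalientCone C) :
    ∃ ℓ : E →L[ℝ] ℝ, ∀ x ∈ closure C, ‖x‖ ≤ ℓ x := by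
  obtain ⟨ℓ, hℓ⟩ := hC.salient
  exact ⟨ℓ, fun x hx => closure_minimal hℓ (isClosed_le continuous_norm ℓ.continuous) hx⟩

theorem eq_zero_of_neg_mem (hC : IsSalientCone C) {x : E} (hx : x ∈ closure C)
    (hx' : -x ∈ closure C) : x = 0 := by
  obtain ⟨ℓ, hℓ⟩ := hC.exists_norm_le
  have h1 := hℓ x hx
  have h2 := hℓ _ hx'
  rw [norm_neg, map_neg] at h2
  exact norm_le_zero_iff.1 (by linarith)

theorem exists_support (hC : IsSalientCone C) {y : E} (hy : y ∈ closure C) (hy' : y ∉ C) :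
    ∃ φ : E →L[ℝ] ℝ, (∀ x ∈ closure C, 0 ≤ φ x) ∧ (∀ x ∈ C, 0 < φ x) ∧ φ y = 0 := by
  obtain ⟨f, hf⟩ := geometric_hahn_banach_open_point hC.convex hC.isOpen hy'
  have hle : ∀ x ∈ C, f x ≤ 0 := by
    intro x hx
    by_contra! hpos
    obtain ⟨n, hn⟩ := exists_nat_gt (f y / f x)
    have h := hf _ (hC.smul_mem (n + 1 : ℝ) (by positivity) x hx)
    rw [map_smul, smul_eq_mul] at h
    rw [div_lt_iff₀ hpos] at hn
    nlinarith
  have hcl : ∀ x ∈ closure C, f x ≤ 0 := fun x hx =>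
    closure_minimal hle (isClosed_le f.continuous continuous_const) hx
  have h0 : 0 ≤ f y := by
    have : ∀ x ∈ closure C, f x ≤ f y := fun x hx =>
      closure_minimal (fun z hz => (hf z hz).le) (isClosed_le f.continuous continuous_const) hx
    simpa using this 0 hC.zero_mem_closure
  have hy0 : f y = 0 := le_antisymm (hcl y hy) h0
  refine ⟨-f, fun x hx => by simpa using hcl x hx, fun x hx => ?_, by simpa using hy0⟩
  have := hf x hx
  rw [hy0] at this
  simpa using this

end IsSalientCone

/-- A salient cone with a cocompact group of linear automorphisms that does not split as a
product of two cones. -/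
structure IsDivisibleCone (C : Set E) : Prop extends IsSalientCone C where
  cocompact : ∃ K ⊆ C, IsCompact K ∧ ∀ x ∈ C, ∃ g : E ≃L[ℝ] E, g '' C = C ∧ g x ∈ K
  irreducible : ∀ P : E →ₗ[ℝ] E, (∀ x, P (P x) = P x) → (∀ x ∈ closure C, P x ∈ closure C) →
    (∀ x ∈ closure C, x - P x ∈ closure C) → P = 0 ∨ P = LinearMap.id

theorem mem_closure_of_image_eq {C : Set E} {g : E ≃L[ℝ] E} (hg : g '' C = C) {x : E}
    (hx : x ∈ closure C) : g x ∈ closure C :=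
  map_mem_closure g.continuous hx fun _ hy => hg ▸ mem_image_of_mem g hy

theorem mem_of_image_eq {C : Set E} {g : E ≃L[ℝ] E} (hg : g '' C = C) {x : E} (hx : x ∈ C) :
    g x ∈ C := hg ▸ mem_image_of_mem g hx

theorem symm_image_eq {C : Set E} {g : E ≃L[ℝ] E} (hg : g '' C = C) : g.symm '' C = C := by
  conv_lhs => rw [← hg]
  simp [image_image]

theorem exists_tendsto_of_norm_le {F ι : Type*} [NormedAddCommGroup F] [ProperSpace F]
    (U : Ultrafilter ι) {f : ι → F} {R : ℝ} (h : ∀ᶠ n in (U : Filter ι), ‖f n‖ ≤ R) :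
    ∃ a, Tendsto f U (𝓝 a) := by
  obtain ⟨a, -, ha⟩ := (isCompact_closedBall (0 : F) R).ultrafilter_le_nhds (U.map f) (by
    rw [Ultrafilter.coe_map, le_principal_iff, mem_map]
    filter_upwards [h] with n hn
    simpa using hn)
  exact ⟨a, ha⟩

end Cone

section Cone

variable {E : Type*} [NormedAddCommGroup E] [NormedSpace ℝ E]

/-- The common kernel of the functionals supporting `C` at `z`. -/
def supportLineality (C : Set E) (z : E) : Submodule ℝ E where
  carrier := {q | ∀ φ : E →L[ℝ] ℝ, (∀ x ∈ closure C, 0 ≤ φ x) → φ z = 0 → φ q = 0}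
  add_mem' := fun ha hb φ h1 h2 => by simp [ha φ h1 h2, hb φ h1 h2]
  zero_mem' := fun φ _ _ => map_zero φ
  smul_mem' := fun c x hx φ h1 h2 => by simp [hx φ h1 h2]

variable [FiniteDimensional ℝ E]

theorem exists_projection (L : Submodule ℝ E) :
    ∃ P : E →L[ℝ] E, (∀ x, P x ∈ L) ∧ ∀ x ∈ L, P x = x := by
  obtain ⟨f, hf⟩ := LinearMap.exists_leftInverse_of_injective L.subtype L.ker_subtype
  refine ⟨LinearMap.toContinuousLinearMap (L.subtype ∘ₗ f), fun x => by simp, fun x hx => ?_⟩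
  have := LinearMap.congr_fun hf ⟨x, hx⟩
  simp only [LinearMap.comp_apply, Submodule.subtype_apply, LinearMap.id_apply] at this
  simp [this]

theorem eventually_add_mem_closure {C : Set E} (hC : IsSalientCone C) {z : E}
    (hz : z ∈ closure C) {L : Submodule ℝ E}
    (hL : ∀ q ∈ L, ∃ ε : ℝ, 0 < ε ∧ z + ε • q ∈ closure C ∧ z - ε • q ∈ closure C) :
    ∀ᶠ v : L in 𝓝 0, z + (v : E) ∈ closure C := by
  let b := Module.finBasis ℝ L
  set m := Module.finrank ℝ L
  have hcoord : ∀ i, ∀ᶠ v : L in 𝓝 0, z + (b.repr v i) • (b i : E) ∈ closure C := by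
    intro i
    obtain ⟨ε, hε, h1, h2⟩ := hL (b i) (b i).2
    have hcont : Continuous fun v : L => b.repr v i :=
      (LinearMap.continuous_of_finiteDimensional (b.coord i))
    have hnear : ∀ᶠ v : L in 𝓝 0, b.repr v i ∈ Icc (-ε) ε := by
      refine hcont.continuousAt.eventually_mem (Icc_mem_nhds ?_ ?_) <;> simp [hε]
    filter_upwards [hnear] with v hv
    have hcv := hC.convex.closure h1 h2 (a := (ε + b.repr v i) / (2 * ε))
      (b := (ε - b.repr v i) / (2 * ε)) (div_nonneg (by linarith [hv.1]) (by linarith))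
      (div_nonneg (by linarith [hv.2]) (by linarith)) (by field_simp; ring)
    convert hcv using 1
    match_scalars <;> field_simp <;> ring
  have hall : ∀ᶠ v : L in 𝓝 0, ((m : ℝ) + 1) • z + (v : E) ∈ closure C := by
    filter_upwards [eventually_all.2 hcoord] with v hv
    have hs := hC.add_mem_closure hz (hC.sum_mem_closure Finset.univ fun i _ => hv i)
    have hv' : (v : E) = ∑ i, (b.repr v i) • (b i : E) := by
      have := congrArg L.subtype (b.sum_repr v)
      simp only [map_sum, map_smul, Submodule.subtype_apply] at this
      exact this.symm
    rw [Finset.sum_add_distrib, ← hv'] at hs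
    simp only [Finset.sum_const, Finset.card_univ, Fintype.card_fin] at hs
    convert hs using 1
    rw [add_smul, ← Nat.cast_smul_eq_nsmul ℝ, one_smul]
    abel
  have hscale : Tendsto (fun v : L => ((m : ℝ) + 1) • v) (𝓝 0) (𝓝 0) := by
    have := (continuous_const_smul (T := L) ((m : ℝ) + 1)).tendsto 0
    simpa using this
  filter_upwards [hscale.eventually hall] with v hv
  have := hC.smul_mem_closure (t := ((m : ℝ) + 1)⁻¹) (by positivity) hv
  have hm : (m : ℝ) + 1 ≠ 0 := by positivity
  simpa [smul_smul, inv_mul_cancel₀ hm] using this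

end Cone

section Cone

variable {E : Type*} [NormedAddCommGroup E] [NormedSpace ℝ E] [FiniteDimensional ℝ E]

/-- Elements of the cone below `M • (z + (c - P c) / n)` asymptotically split along the
projection `P` onto the lineality space at `z`. -/
theorem eventually_projection_mem {C : Set E} (hC : IsSalientCone C) {z c : E}
    (hc : c ∈ C) (hL : ∀ᶠ v : supportLineality C z in 𝓝 0, z + (v : E) ∈ closure C)
    {P : E →L[ℝ] E} (hP : ∀ x, P x ∈ supportLineality C z)
    (hP' : ∀ x ∈ supportLineality C z, P x = x)
    {U : Ultrafilter ℕ} (hU : (U : Filter ℕ) ≤ atTop) {M : ℝ} {p : ℕ → E}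
    (hp : ∀ n : ℕ, p n = z + (n : ℝ)⁻¹ • (c - P c)) {y : ℕ → E}
    (hy : ∀ᶠ n in (U : Filter ℕ), y n ∈ closure C)
    (hy' : ∀ᶠ n in (U : Filter ℕ), M • p n - y n ∈ closure C) {δ : ℝ} (hδ : 0 < δ) :
    ∀ᶠ n in (U : Filter ℕ),
      P (y n) + δ • p n ∈ closure C ∧ y n - P (y n) + δ • p n ∈ closure C := by
  set L := supportLineality C z with hLdef
  have hinv : Tendsto (fun n : ℕ => (n : ℝ)⁻¹) U (𝓝 0) :=
    tendsto_inv_atTop_nhds_zero_nat.mono_left hU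
  have hpos : ∀ᶠ n : ℕ in (U : Filter ℕ), 0 < (n : ℝ) :=
    hU ((eventually_gt_atTop 0).mono fun n hn => by exact_mod_cast hn)
  have hPz : P z = z := hP' z fun φ _ h => h
  have hvan : ∀ φ : E →L[ℝ] ℝ, (∀ x ∈ closure C, 0 ≤ φ x) → φ z = 0 → ∀ x, φ (P x) = 0 :=
    fun φ h1 h2 x => hP x φ h1 h2
  have hLε : ∀ (v : ℕ → E) (ε : ℝ), 0 < ε → (∀ n, v n ∈ L) → Tendsto v U (𝓝 0) →
      ∀ᶠ n in (U : Filter ℕ), ε • z + v n ∈ closure C := by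
    intro v ε hε hv hlim
    have hlim' : Tendsto (fun n => (⟨ε⁻¹ • v n, L.smul_mem _ (hv n)⟩ : L)) U (𝓝 0) := by
      rw [tendsto_subtype_rng]
      simpa using hlim.const_smul ε⁻¹
    filter_upwards [hlim'.eventually hL] with n hn
    have := hC.smul_mem_closure hε.le hn
    simpa [smul_smul, hε.ne'] using this
  have hplim : Tendsto p U (𝓝 z) := by
    have := (hinv.smul_const (c - P c)).const_add z
    simpa [funext hp] using this
  obtain ⟨ℓ, hℓ⟩ := hC.exists_norm_le
  obtain ⟨y₀, hy₀⟩ : ∃ a, Tendsto y U (𝓝 a) := by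
    refine exists_tendsto_of_norm_le U (R := ℓ (M • z) + 1) ?_
    have hl : Tendsto (fun n => ℓ (M • p n)) U (𝓝 (ℓ (M • z))) :=
      (ℓ.continuous.tendsto _).comp (hplim.const_smul M)
    filter_upwards [hy, hy', hl.eventually (gt_mem_nhds (lt_add_one _))] with n h1 h2 h3
    have h4 := hℓ _ h1
    have h5 := (norm_nonneg _).trans (hℓ _ h2)
    rw [map_sub] at h5
    linarith
  set ω : ℕ → E := fun n => (n : ℝ) • (y n - P (y n)) with hω
  have hPω : ∀ n, P (ω n) = 0 := fun n => by
    simp [hω, map_sub, hP' _ (hP (y n))]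
  obtain ⟨R, hR⟩ : ∃ R : ℝ, ∀ᶠ n in (U : Filter ℕ), ‖ω n‖ ≤ R := by
    by_contra! hcon
    have hbig : Tendsto (fun n => ‖ω n‖) U atTop := by
      refine tendsto_atTop.2 fun R => ?_
      exact (hcon R).mono fun n hn => hn.le
    have hinv' : Tendsto (fun n => ‖ω n‖⁻¹) U (𝓝 0) := tendsto_inv_atTop_zero.comp hbig
    have hωpos : ∀ᶠ n in (U : Filter ℕ), 0 < ‖ω n‖ := hbig.eventually (eventually_gt_atTop 0)
    have hunit : ∀ᶠ n in (U : Filter ℕ), ‖‖ω n‖⁻¹ • ω n‖ = 1 := by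
      filter_upwards [hωpos] with n hn
      rw [norm_smul, norm_inv, norm_norm, inv_mul_cancel₀ hn.ne']
    obtain ⟨u, hu⟩ := exists_tendsto_of_norm_le U (hunit.mono fun n hn => hn.le)
    have hu1 : ‖u‖ = 1 := by
      have := tendsto_nhds_unique (hu.norm.congr' hunit) tendsto_const_nhds
      exact this
    have hPu : P u = 0 := by
      refine tendsto_nhds_unique ((P.continuous.tendsto u).comp hu) ?_
      simp [Function.comp_def, hPω]
    have huL : u ∈ L := by
      intro φ h1 h2
      have hφu : Tendsto (fun n => ‖ω n‖⁻¹ * φ (ω n)) U (𝓝 (φ u)) := by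
        have := (φ.continuous.tendsto u).comp hu
        simpa [Function.comp_def] using this
      have hφω : ∀ n : ℕ, φ (ω n) = n * φ (y n) := fun n => by
        simp [hω, hvan φ h1 h2]
      apply le_antisymm
      · have hb : Tendsto (fun n => ‖ω n‖⁻¹ * (M * φ c)) U (𝓝 0) := by
          simpa using hinv'.mul_const (M * φ c)
        refine le_of_tendsto_of_tendsto hφu hb ?_
        filter_upwards [hy', hpos] with n hn hn0
        have h3 := h1 _ hn
        rw [hp] at h3
        simp only [map_sub, map_smul, map_add, smul_eq_mul, h2, hvan φ h1 h2] at h3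
        refine mul_le_mul_of_nonneg_left ?_ (by positivity)
        rw [hφω]
        have h4 := mul_nonneg hn0.le h3
        have : (n : ℝ) * (M * (0 + (n : ℝ)⁻¹ * (φ c - 0)) - φ (y n)) =
          M * φ c - n * φ (y n) := by field_simp; ring
        linarith
      · refine ge_of_tendsto hφu ?_
        filter_upwards [hy] with n hn
        rw [hφω]
        have := h1 _ hn
        positivity
    rw [hP' u huL] at hPu
    rw [hPu, norm_zero] at hu1
    exact zero_ne_one hu1
  obtain ⟨ω₀, hω₀⟩ := exists_tendsto_of_norm_le U hR
  have hwlim : Tendsto (fun n => y n - P (y n)) U (𝓝 0) := by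
    have h := hinv.smul hω₀
    rw [zero_smul] at h
    refine h.congr' ?_
    filter_upwards [hpos] with n hn
    simp [hω, smul_smul, hn.ne']
  have hPy₀ : P y₀ = y₀ := by
    have h1 := hy₀.sub ((P.continuous.tendsto y₀).comp hy₀)
    exact (sub_eq_zero.1 (tendsto_nhds_unique h1 hwlim)).symm
  have hy₀L : y₀ ∈ L := hPy₀ ▸ hP y₀
  have hy₀C : y₀ ∈ closure C := isClosed_closure.mem_of_tendsto hy₀ hy
  refine Filter.Eventually.and ?_ ?_
  · have hv : Tendsto (fun n => (P (y n) - y₀) - (δ * (n : ℝ)⁻¹) • P c) U (𝓝 0) := by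
      have h1 := ((P.continuous.tendsto y₀).comp hy₀).sub_const y₀
      have h2 := (hinv.const_mul δ).smul_const (P c)
      simpa [hPy₀] using h1.sub h2
    filter_upwards [hLε _ δ hδ (fun n => L.sub_mem (L.sub_mem (hP _) hy₀L)
      (L.smul_mem _ (hP c))) hv, hpos] with n hn hn0
    have h3 := hC.add_mem_closure (hC.add_mem_closure hy₀C hn)
      (hC.smul_mem_closure (t := δ * (n : ℝ)⁻¹) (by positivity) (subset_closure hc))
    convert h3 using 1
    rw [hp]
    module
  · obtain ⟨r, hr, hball⟩ := Metric.isOpen_iff.1 hC.isOpen _ (hC.smul_mem δ hδ c hc)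
    obtain ⟨N, hN, hNy⟩ : ∃ N, dist (ω N) ω₀ < r / 2 ∧ y N ∈ closure C :=
      ((hω₀.eventually (ball_mem_nhds _ (half_pos hr))).and hy).exists
    have hv : Tendsto (fun n : ℕ => -((n : ℝ)⁻¹ • ((N : ℝ) • P (y N) + δ • P c))) U (𝓝 0) := by
      simpa using (hinv.smul_const ((N : ℝ) • P (y N) + δ • P c)).neg
    filter_upwards [hLε _ δ hδ (fun n => L.neg_mem (L.smul_mem _ (L.add_mem
      (L.smul_mem _ (hP _)) (L.smul_mem _ (hP _))))) hv, hpos,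
      hω₀.eventually (ball_mem_nhds _ (half_pos hr))] with n hn hn0 hnear
    have hnear' : dist (ω n) (ω N) < r := by
      have := dist_triangle_right (ω n) (ω N) ω₀
      have h' : dist (ω n) ω₀ < r / 2 := hnear
      linarith
    have hmem : δ • c + (ω n - ω N) ∈ C := hball (by
      rw [mem_ball, dist_eq_norm]
      rwa [dist_eq_norm, ← add_sub_cancel_left (δ • c) (ω n - ω N)] at hnear')
    have h3 := hC.add_mem_closure (hC.smul_mem_closure (Nat.cast_nonneg N) hNy)
      (subset_closure hmem)
    have h4 := hC.add_mem_closure hn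
      (hC.smul_mem_closure (t := (n : ℝ)⁻¹) (by positivity) h3)
    convert h4 using 1
    rw [hp]
    simp only [hω]
    match_scalars <;> field_simp <;> ring

end Cone

section Cone

variable {E : Type*} [NormedAddCommGroup E] [NormedSpace ℝ E]

theorem IsSalientCone.exists_smul_sub_mem {C K : Set E} (hC : IsSalientCone C)
    (hK : IsCompact K) (hKC : K ⊆ C) (x : E) : ∃ M : ℝ, 0 < M ∧ ∀ k ∈ K, M • k - x ∈ C := by
  obtain ⟨δ, hδ, hsub⟩ := hK.exists_cthickening_subset_open hC.isOpen hKC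
  have hpos : 0 < δ / (‖x‖ + 1) := by positivity
  refine ⟨(δ / (‖x‖ + 1))⁻¹, inv_pos.2 hpos, fun k hk => ?_⟩
  have hmem : k - (δ / (‖x‖ + 1)) • x ∈ C := by
    refine hsub (closedBall_subset_cthickening hk δ ?_)
    rw [mem_closedBall, dist_eq_norm, sub_sub_cancel_left, norm_neg, norm_smul, Real.norm_eq_abs,
      abs_of_pos hpos, div_mul_eq_mul_div, div_le_iff₀ (by positivity)]
    nlinarith [norm_nonneg x]
  have := hC.smul_mem _ (inv_pos.2 hpos) _ hmem
  rwa [smul_sub, smul_smul, inv_mul_cancel₀ hpos.ne', one_smul] at this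

variable [FiniteDimensional ℝ E]

theorem exists_limit_of_eventually_split {C : Set E} (hC : IsSalientCone C)
    {U : Ultrafilter ℕ} {Q : ℕ → E →L[ℝ] E} {k : ℕ → E} {R : ℝ} (hk : ∀ n, ‖k n‖ ≤ R)
    (hQ : ∀ x ∈ closure C, ∀ δ : ℝ, 0 < δ → ∀ᶠ n in (U : Filter ℕ),
      Q n x + δ • k n ∈ closure C ∧ x - Q n x + δ • k n ∈ closure C) :
    ∃ T : E →ₗ[ℝ] E, (∀ x, Tendsto (fun n => Q n x) U (𝓝 (T x))) ∧
      (∀ x ∈ closure C, T x ∈ closure C) ∧ ∀ x ∈ closure C, x - T x ∈ closure C := by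
  obtain ⟨ℓ, hℓ⟩ := hC.exists_norm_le
  obtain ⟨c, hc⟩ := hC.nonempty
  have hcone : ∀ x ∈ closure C, ∃ a, Tendsto (fun n => Q n x) U (𝓝 a) := by
    intro x hx
    refine exists_tendsto_of_norm_le U (R := ℓ x + 2 * (‖ℓ‖ * R) + R) ?_
    filter_upwards [hQ x hx 1 one_pos] with n hn
    rw [one_smul] at hn
    have h1 := hℓ _ hn.1
    have h2 := (norm_nonneg _).trans (hℓ _ hn.2)
    simp only [map_add, map_sub] at h1 h2
    have h3 : ℓ (k n) ≤ ‖ℓ‖ * R := (le_abs_self _).trans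
      ((ℓ.le_opNorm _).trans (mul_le_mul_of_nonneg_left (hk n) (norm_nonneg _)))
    have h4 := norm_sub_le (Q n x + k n) (k n)
    rw [add_sub_cancel_right] at h4
    linarith [hk n]
  have hall : ∀ x, ∃ a, Tendsto (fun n => Q n x) U (𝓝 a) := by
    intro x
    obtain ⟨M, hM, hMx⟩ := hC.exists_smul_sub_mem isCompact_singleton
      (singleton_subset_iff.2 hc) x
    obtain ⟨a, ha⟩ := hcone _ (subset_closure (hC.smul_mem M hM c hc))
    obtain ⟨b, hb⟩ := hcone _ (subset_closure (hMx c rfl))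
    refine ⟨a - b, ?_⟩
    refine (ha.sub hb).congr fun n => ?_
    rw [← map_sub, sub_sub_cancel]
  choose f hf using hall
  let T : E →ₗ[ℝ] E := linearMapOfTendsto f (fun n => (Q n : E →ₗ[ℝ] E))
    (tendsto_pi_nhds.2 hf)
  have hmem : ∀ (w : ℕ → E) (a : E), Tendsto w U (𝓝 a) →
      (∀ δ : ℝ, 0 < δ → ∀ᶠ n in (U : Filter ℕ), w n + δ • k n ∈ closure C) → a ∈ closure C := by
    intro w a hw hδ
    obtain ⟨b, hb⟩ := exists_tendsto_of_norm_le U (Eventually.of_forall hk)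
    have h1 : ∀ δ : ℝ, 0 < δ → a + δ • b ∈ closure C := fun δ h =>
      isClosed_closure.mem_of_tendsto (hw.add (hb.const_smul δ)) (hδ δ h)
    have h2 : Tendsto (fun δ : ℝ => a + δ • b) (𝓝[>] 0) (𝓝 (a + (0 : ℝ) • b)) :=
      ((continuous_const.add (continuous_id.smul continuous_const)).tendsto
        (0 : ℝ)).mono_left nhdsWithin_le_nhds
    have := isClosed_closure.mem_of_tendsto h2 (eventually_nhdsWithin_of_forall h1)
    simpa using this
  exact ⟨T, hf, fun x hx => hmem _ _ (hf x) fun δ h => (hQ x hx δ h).mono fun _ h => h.1,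
    fun x hx => hmem _ _ ((hf x).const_sub x) fun δ h => (hQ x hx δ h).mono fun _ h => h.2⟩

theorem tendsto_apply_of_tendsto {U : Filter ℕ} {Q : ℕ → E →L[ℝ] E} {T : E →ₗ[ℝ] E}
    (hQ : ∀ x, Tendsto (fun n => Q n x) U (𝓝 (T x))) {u : ℕ → E} {a : E}
    (hu : Tendsto u U (𝓝 a)) : Tendsto (fun n => Q n (u n)) U (𝓝 (T a)) := by
  let b := Module.finBasis ℝ E
  have hexp : ∀ n x, Q n x = ∑ i, b.repr x i • Q n (b i) := fun n x => by
    conv_lhs => rw [← b.sum_repr x]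
    simp only [map_sum, map_smul]
  have hT : T a = ∑ i, b.repr a i • T (b i) := by
    conv_lhs => rw [← b.sum_repr a]
    simp only [map_sum, map_smul]
  simp only [hexp _ (u _), hT]
  refine tendsto_finsetSum _ fun i _ => Tendsto.smul ?_ (hQ _)
  exact ((b.coord i).continuous_of_finiteDimensional.tendsto a).comp hu

theorem tendsto_trace_of_tendsto {U : Filter ℕ} {Q : ℕ → E →L[ℝ] E} {T : E →ₗ[ℝ] E}
    (hQ : ∀ x, Tendsto (fun n => Q n x) U (𝓝 (T x))) :
    Tendsto (fun n => LinearMap.trace ℝ E (Q n : E →ₗ[ℝ] E)) U (𝓝 (LinearMap.trace ℝ E T)) := by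
  let b := Module.finBasis ℝ E
  simp only [LinearMap.trace_eq_matrix_trace ℝ b, Matrix.trace, Matrix.diag,
    LinearMap.toMatrix_apply]
  refine tendsto_finsetSum _ fun i _ => ?_
  exact ((b.coord i).continuous_of_finiteDimensional.tendsto _).comp (hQ (b i))

/-- At a nonzero boundary point of a divisible cone, the face cannot be open in the
common kernel of the supporting functionals. -/
theorem IsDivisibleCone.exists_mem_supportLineality {C : Set E} (hC : IsDivisibleCone C) {z : E}
    (hz : z ∈ closure C) (hz' : z ∉ C) (hz0 : z ≠ 0) :
    ∃ q ∈ supportLineality C z, ∀ ε : ℝ, 0 < ε →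
      ¬ (z + ε • q ∈ closure C ∧ z - ε • q ∈ closure C) := by
  by_contra! hcon
  have hS := hC.toIsSalientCone
  have hL := eventually_add_mem_closure hS hz hcon
  obtain ⟨P, hP, hP'⟩ := exists_projection (supportLineality C z)
  obtain ⟨K, hKC, hK, hcov⟩ := hC.cocompact
  obtain ⟨c, hc⟩ := hC.nonempty
  set p : ℕ → E := fun n => z + (n : ℝ)⁻¹ • (c - P c) with hp
  let U : Ultrafilter ℕ := hyperfilter ℕ
  have hU : (U : Filter ℕ) ≤ atTop := Nat.hyperfilter_le_atTop
  have hinv : Tendsto (fun n : ℕ => (n : ℝ)⁻¹) U (𝓝 0) :=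
    tendsto_inv_atTop_nhds_zero_nat.mono_left hU
  have hpC : ∀ᶠ n in (U : Filter ℕ), p n ∈ C := by
    have hlim : Tendsto (fun n : ℕ => (⟨-((n : ℝ)⁻¹ • P c),
        (supportLineality C z).neg_mem ((supportLineality C z).smul_mem _ (hP c))⟩ :
        supportLineality C z)) U (𝓝 0) := by
      rw [tendsto_subtype_rng]
      simpa using (hinv.smul_const (P c)).neg
    filter_upwards [hlim.eventually hL, hU (eventually_gt_atTop 0)] with n hn hn0
    have h0 : (0 : ℝ) < (n : ℝ)⁻¹ := inv_pos.2 (by exact_mod_cast hn0)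
    have := hS.add_mem (hS.smul_mem _ h0 c hc) hn
    convert this using 1
    simp only [hp]
    module
  have hex : ∀ n, ∃ g : E ≃L[ℝ] E, g '' C = C ∧ (p n ∈ C → g (p n) ∈ K) := fun n => by
    by_cases h : p n ∈ C
    · obtain ⟨g, h1, h2⟩ := hcov _ h
      exact ⟨g, h1, fun _ => h2⟩
    · exact ⟨ContinuousLinearEquiv.refl ℝ E, by simp, fun h' => absurd h' h⟩
  choose g hgC hgK using hex
  obtain ⟨R, hR⟩ := hK.isBounded.exists_norm_le
  obtain ⟨κ, hκ⟩ : K.Nonempty := by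
    obtain ⟨n, hn⟩ := hpC.exists
    exact ⟨_, hgK n hn⟩
  classical
  set k : ℕ → E := fun n => if p n ∈ C then g n (p n) else κ with hk
  have hkK : ∀ n, k n ∈ K := fun n => by
    simp only [hk]
    split_ifs with h
    exacts [hgK n h, hκ]
  set Q : ℕ → E →L[ℝ] E := fun n =>
    ((g n : E →L[ℝ] E).comp P).comp ((g n).symm : E →L[ℝ] E) with hQ
  obtain ⟨T, hT, hT1, hT2⟩ := exists_limit_of_eventually_split hS (U := U) (Q := Q) (k := k)
    (fun n => hR _ (hkK n)) (by
      intro x hx δ hδ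
      obtain ⟨M, hM, hMx⟩ := hS.exists_smul_sub_mem hK hKC x
      have hy : ∀ n, (g n).symm x ∈ closure C := fun n =>
        mem_closure_of_image_eq (symm_image_eq (hgC n)) hx
      have hev := eventually_projection_mem hS hc hL hP hP' hU (M := M) (p := p)
        (fun n => rfl) (Eventually.of_forall hy) (by
          filter_upwards [hpC] with n hn
          have := mem_closure_of_image_eq (symm_image_eq (hgC n))
            (subset_closure (hMx _ (hgK n hn)))
          simpa using this) hδ
      filter_upwards [hev, hpC] with n hn hn'
      have h1 := mem_closure_of_image_eq (hgC n) hn.1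
      have h2 := mem_closure_of_image_eq (hgC n) hn.2
      simp only [hk, if_pos hn', hQ]
      simpa using And.intro h1 h2)
  have hPP : ∀ x, P (P x) = P x := fun x => hP' _ (hP x)
  have hidem : ∀ x, T (T x) = T x := by
    intro x
    refine tendsto_nhds_unique (tendsto_apply_of_tendsto hT (hT x)) ?_
    refine (hT x).congr fun n => ?_
    simp [hQ, hPP]
  have htrP : LinearMap.trace ℝ E (P : E →ₗ[ℝ] E) =
      Module.finrank ℝ (supportLineality C z) := by
    refine LinearMap.IsProj.trace ⟨hP, hP'⟩
  have htr : LinearMap.trace ℝ E T = Module.finrank ℝ (supportLineality C z) := by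
    refine tendsto_nhds_unique (tendsto_trace_of_tendsto hT) ?_
    refine tendsto_const_nhds.congr fun n => ?_
    rw [← htrP, ← LinearMap.trace_conj' (P : E →ₗ[ℝ] E) (g n).toLinearEquiv]
    rfl
  have hzL : z ∈ supportLineality C z := fun φ _ h => h
  rcases hC.irreducible T hidem hT1 hT2 with h | h
  · rw [h, map_zero] at htr
    have h0 : Module.finrank ℝ (supportLineality C z) = 0 := by exact_mod_cast htr.symm
    rw [Submodule.finrank_eq_zero] at h0
    rw [h0] at hzL
    exact hz0 ((Submodule.mem_bot ℝ).1 hzL)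
  · rw [h, LinearMap.trace_id] at htr
    have h0 : Module.finrank ℝ (supportLineality C z) = Module.finrank ℝ E := by
      exact_mod_cast htr.symm
    have htop := Submodule.eq_top_of_finrank_eq h0
    obtain ⟨φ, h1, h2, h3⟩ := hS.exists_support hz hz'
    have hcL : c ∈ supportLineality C z := htop ▸ Submodule.mem_top
    have := hcL φ h1 h3
    exact (h2 c hc).ne' this

end Cone

section Cone

variable {E : Type*} [NormedAddCommGroup E] [NormedSpace ℝ E]

/-- `y` is tangent at `z` to the face of the closure of `C` containing `z`. -/
def IsFaceDirection (C : Set E) (z y : E) : Prop :=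
  ∃ ε : ℝ, 0 < ε ∧ z + ε • y ∈ closure C ∧ z - ε • y ∈ closure C

namespace IsFaceDirection

variable {C : Set E} {z y y' : E}

theorem of_sub_mem (hC : IsSalientCone C) (hz : z ∈ closure C) (hy : y ∈ closure C) {ε : ℝ}
    (hε : 0 < ε) (h : z - ε • y ∈ closure C) : IsFaceDirection C z y :=
  ⟨ε, hε, hC.add_mem_closure hz (hC.smul_mem_closure hε.le hy), h⟩

theorem smul (hz : z ∈ closure C) (h : IsFaceDirection C z y) (t : ℝ) :
    IsFaceDirection C z (t • y) := by
  obtain ⟨ε, hε, h1, h2⟩ := h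
  rcases lt_trichotomy t 0 with ht | ht | ht
  · refine ⟨ε / -t, div_pos hε (by linarith), ?_, ?_⟩
    · rw [smul_smul, show ε / -t * t = -ε by have := ht.ne; field_simp, neg_smul, ← sub_eq_add_neg]
      exact h2
    · rw [smul_smul, show ε / -t * t = -ε by have := ht.ne; field_simp, neg_smul, sub_neg_eq_add]
      exact h1
  · exact ⟨1, one_pos, by simpa [ht] using hz, by simpa [ht] using hz⟩
  · refine ⟨ε / t, by positivity, ?_, ?_⟩
    · rwa [smul_smul, div_mul_cancel₀ _ ht.ne']
    · rwa [smul_smul, div_mul_cancel₀ _ ht.ne']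

theorem shrink (hC : IsSalientCone C) (hz : z ∈ closure C) {ε δ : ℝ} (hδ : 0 < δ) (h : δ ≤ ε)
    (h1 : z + ε • y ∈ closure C) : z + δ • y ∈ closure C := by
  have hε : 0 < ε := hδ.trans_le h
  have := hC.convex.closure hz h1 (a := 1 - δ / ε) (b := δ / ε)
    (sub_nonneg.2 ((div_le_one hε).2 h)) (by positivity) (by ring)
  convert this using 1
  match_scalars
  · field_simp
    ring
  · field_simp

theorem add (hC : IsSalientCone C) (hz : z ∈ closure C) (h : IsFaceDirection C z y)
    (h' : IsFaceDirection C z y') : IsFaceDirection C z (y + y') := by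
  obtain ⟨ε, hε, h1, h2⟩ := h
  obtain ⟨ε', hε', h1', h2'⟩ := h'
  set δ := min ε ε' with hδ
  have hδ0 : 0 < δ := lt_min hε hε'
  rw [sub_eq_add_neg, ← smul_neg] at h2 h2'
  have hmid : ∀ a b : E, z + δ • a ∈ closure C → z + δ • b ∈ closure C →
      z + (δ / 2) • (a + b) ∈ closure C := fun a b ha hb => by
    have := hC.convex.closure ha hb (by norm_num : (0 : ℝ) ≤ 1 / 2)
      (by norm_num : (0 : ℝ) ≤ 1 / 2) (by norm_num)
    convert this using 1
    module
  refine ⟨δ / 2, by positivity, ?_, ?_⟩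
  · exact hmid _ _ (shrink hC hz hδ0 (min_le_left _ _) h1) (shrink hC hz hδ0 (min_le_right _ _) h1')
  · have := hmid _ _ (shrink hC hz hδ0 (min_le_left _ _) h2)
      (shrink hC hz hδ0 (min_le_right _ _) h2')
    rw [← neg_add, smul_neg, ← sub_eq_add_neg] at this
    exact this

theorem sub (hC : IsSalientCone C) (hz : z ∈ closure C) (h : IsFaceDirection C z y)
    (h' : IsFaceDirection C z y') : IsFaceDirection C z (y - y') := by
  simpa [sub_eq_add_neg] using h.add hC hz (h'.smul hz (-1))

theorem sum (hC : IsSalientCone C) (hz : z ∈ closure C) {ι : Type*} (s : Finset ι) {f : ι → E}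
    (h : ∀ i ∈ s, IsFaceDirection C z (f i)) : IsFaceDirection C z (∑ i ∈ s, f i) := by
  classical
  induction s using Finset.induction_on with
  | empty => exact ⟨1, one_pos, by simpa using hz, by simpa using hz⟩
  | insert a s ha ih =>
    rw [Finset.sum_insert ha]
    exact (h a (Finset.mem_insert_self a s)).add hC hz
      (ih fun i hi => h i (Finset.mem_insert_of_mem hi))

theorem map_eq_zero (h : IsFaceDirection C z y) {φ : E →L[ℝ] ℝ} (hφ : ∀ x ∈ closure C, 0 ≤ φ x)
    (hz : φ z = 0) : φ y = 0 := by
  obtain ⟨ε, hε, h1, h2⟩ := h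
  have h3 := hφ _ h1
  have h4 := hφ _ h2
  simp only [map_add, map_sub, map_smul, hz, smul_eq_mul] at h3 h4
  nlinarith

end IsFaceDirection

/-- The extremal generators of a flat: positive combinations lie in `C`, and nonnegative
combinations with a vanishing coefficient do not. -/
structure IsLinFlat {ι : Type*} [Fintype ι] (C : Set E) (e : ι → E) : Prop where
  linearIndependent : LinearIndependent ℝ e
  sum_mem : ∀ c : ι → ℝ, (∀ i, 0 < c i) → ∑ i, c i • e i ∈ C
  sum_notMem : ∀ c : ι → ℝ, (∀ i, 0 ≤ c i) → (∃ i, c i = 0) → ∑ i, c i • e i ∉ C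

namespace IsLinFlat

variable {ι : Type*} [Fintype ι] {C : Set E} {e f : ι → E}

theorem sum_mem_closure (he : IsLinFlat C e) {c : ι → ℝ} (hc : ∀ i, 0 ≤ c i) :
    ∑ i, c i • e i ∈ closure C := by
  have hlim : Tendsto (fun s : ℝ => ∑ i, (c i + s) • e i) (𝓝[>] 0)
      (𝓝 (∑ i, (c i + 0) • e i)) :=
    ((continuous_finsetSum _ fun i _ =>
      (continuous_const.add continuous_id).smul continuous_const).tendsto (0 : ℝ)).mono_left
        nhdsWithin_le_nhds
  simp only [add_zero] at hlim
  refine mem_closure_of_tendsto hlim (eventually_nhdsWithin_of_forall fun s hs => ?_)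
  exact he.sum_mem _ fun i => add_pos_of_nonneg_of_pos (hc i) hs

theorem mem_closure (he : IsLinFlat C e) (i : ι) : e i ∈ closure C := by
  classical
  have := he.sum_mem_closure (c := Pi.single i 1) fun j => by
    by_cases h : j = i
    · subst h; simp
    · simp [h]
  simpa [Pi.single_apply] using this

theorem sum_univ_mem (he : IsLinFlat C e) : ∑ i, e i ∈ C := by
  simpa using he.sum_mem (fun _ => 1) fun _ => one_pos

theorem coeff_nonneg (hC : IsSalientCone C) (he : IsLinFlat C e) {c : ι → ℝ}
    (hc : ∑ i, c i • e i ∈ closure C) (i : ι) : 0 ≤ c i := by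
  by_contra! hi
  have : Nonempty ι := ⟨i⟩
  obtain ⟨j, hj⟩ := Finite.exists_min c
  have hj0 : c j < 0 := (hj i).trans_lt hi
  refine he.sum_notMem (fun k => c k + -c j) (fun k => by linarith [hj k]) ⟨j, by ring⟩ ?_
  have := hC.add_mem (hC.smul_mem (-c j) (by linarith) _ he.sum_univ_mem) hc
  convert this using 1
  rw [Finset.smul_sum, ← Finset.sum_add_distrib]
  exact Finset.sum_congr rfl fun k _ => by rw [← add_smul, add_comm]

theorem coeff_pos (hC : IsSalientCone C) (he : IsLinFlat C e) {c : ι → ℝ}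
    (hc : ∑ i, c i • e i ∈ C) (i : ι) : 0 < c i := by
  have h := he.coeff_nonneg hC (subset_closure hc)
  exact (h i).lt_of_ne fun h0 => he.sum_notMem c h ⟨i, h0.symm⟩ hc

theorem smul (he : IsLinFlat C e) {c : ι → ℝ} (hc : ∀ i, 0 < c i) :
    IsLinFlat C fun i => c i • e i where
  linearIndependent := by
    have := he.linearIndependent.units_smul fun i => Units.mk0 (c i) (hc i).ne'
    exact this
  sum_mem a ha := by
    simpa [smul_smul] using he.sum_mem (fun i => a i * c i) fun i => mul_pos (ha i) (hc i)
  sum_notMem a ha := by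
    rintro ⟨i, hi⟩
    simpa [smul_smul] using he.sum_notMem (fun i => a i * c i)
      (fun i => mul_nonneg (ha i) (hc i).le) ⟨i, by simp [hi]⟩

theorem map (he : IsLinFlat C e) {g : E ≃L[ℝ] E} (hg : g '' C = C) :
    IsLinFlat C fun i => g (e i) where
  linearIndependent := he.linearIndependent.map' (g : E →ₗ[ℝ] E)
    (LinearMap.ker_eq_bot.2 g.injective)
  sum_mem a ha := by
    have := mem_of_image_eq hg (he.sum_mem a ha)
    simpa [map_sum] using this
  sum_notMem a ha h0 hmem := by
    refine he.sum_notMem a ha h0 ?_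
    have := mem_of_image_eq (symm_image_eq hg) hmem
    simpa [map_sum] using this

theorem of_tendsto (hC : IsSalientCone C) {U : Filter ℕ} [U.NeBot] {f : ℕ → ι → E}
    (hf : ∀ᶠ n in U, IsLinFlat C (f n)) (hlim : ∀ i, Tendsto (fun n => f n i) U (𝓝 (e i)))
    (hsum : ∑ i, e i ∈ C) : IsLinFlat C e := by
  have hcl : ∀ i, e i ∈ closure C := fun i =>
    isClosed_closure.mem_of_tendsto (hlim i) (hf.mono fun n hn => by
      simpa using hn.mem_closure i)
  have hnot : ∀ c : ι → ℝ, (∀ i, 0 ≤ c i) → (∃ i, c i = 0) → ∑ i, c i • e i ∉ C := by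
    intro c hc h0 hmem
    have ht : Tendsto (fun n => ∑ i, c i • f n i) U (𝓝 (∑ i, c i • e i)) :=
      tendsto_finsetSum _ fun i _ => (hlim i).const_smul (c i)
    obtain ⟨n, h1, h2⟩ := ((ht.eventually (hC.isOpen.mem_nhds hmem)).and hf).exists
    exact h2.sum_notMem c hc h0 h1
  refine ⟨?_, fun c hc => ?_, hnot⟩
  · rw [Fintype.linearIndependent_iff]
    intro c hc
    by_contra! hne
    obtain ⟨i₀, hi₀⟩ := hne
    have : Nonempty ι := ⟨i₀⟩
    obtain ⟨j, hj⟩ := Finite.exists_max fun i => |c i|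
    have hjpos : 0 < |c j| := (abs_pos.2 hi₀).trans_le (hj i₀)
    have hle : ∀ i, c i / c j ≤ 1 := fun i => by
      refine (le_abs_self _).trans ?_
      rw [abs_div, div_le_one hjpos]
      exact hj i
    have hcj : c j ≠ 0 := abs_pos.1 hjpos
    refine hnot (fun i => 1 - c i / c j) (fun i => sub_nonneg.2 (hle i)) ⟨j, by simp [hcj]⟩ ?_
    have : ∑ i, (1 - c i / c j) • e i = ∑ i, e i - (c j)⁻¹ • ∑ i, c i • e i := by
      rw [Finset.smul_sum, ← Finset.sum_sub_distrib]
      exact Finset.sum_congr rfl fun i _ => by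
        rw [sub_smul, one_smul, smul_smul, div_eq_inv_mul]
    rw [this, hc, smul_zero, sub_zero]
    exact hsum
  · rcases isEmpty_or_nonempty ι with h | h
    · simpa using hsum
    obtain ⟨j, hj⟩ := Finite.exists_min c
    have h1 := hC.add_mem (hC.smul_mem _ (hc j) _ hsum) (hC.sum_mem_closure Finset.univ
      fun i _ => hC.smul_mem_closure (sub_nonneg.2 (hj i)) (hcl i))
    convert h1 using 1
    rw [Finset.smul_sum, ← Finset.sum_add_distrib]
    exact Finset.sum_congr rfl fun i _ => by module

theorem exists_facet (hC : IsSalientCone C) (he : IsLinFlat C e) (i : ι) :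
    ∃ φ : E →L[ℝ] ℝ, (∀ x ∈ closure C, 0 ≤ φ x) ∧ (∀ k, k ≠ i → φ (e k) = 0) ∧ 0 < φ (e i) := by
  classical
  have hnn : ∀ k, (0 : ℝ) ≤ if k = i then 0 else 1 := fun k => by split_ifs <;> norm_num
  obtain ⟨φ, h1, h2, h3⟩ := hC.exists_support (he.sum_mem_closure hnn)
    (he.sum_notMem _ hnn ⟨i, by simp⟩)
  have hz : ∀ k, k ≠ i → φ (e k) = 0 := by
    rw [map_sum] at h3
    intro k hk
    have := (Finset.sum_eq_zero_iff_of_nonneg fun k _ => by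
      rw [map_smul, smul_eq_mul]
      exact mul_nonneg (hnn k) (h1 _ (he.mem_closure k))).1 h3 k (Finset.mem_univ k)
    simpa [hk] using this
  refine ⟨φ, h1, hz, ?_⟩
  have := h2 _ he.sum_univ_mem
  rwa [map_sum, Finset.sum_eq_single i (fun k _ hk => hz k hk) (by simp)] at this

theorem exists_coeff {x : E} (hx : x ∈ Submodule.span ℝ (range e)) :
    ∃ c : ι → ℝ, x = ∑ i, c i • e i := by
  obtain ⟨c, hc⟩ := (Submodule.mem_span_range_iff_exists_fun ℝ).1 hx
  exact ⟨c, hc.symm⟩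

theorem sum_mem_span (c : ι → ℝ) : ∑ i, c i • e i ∈ Submodule.span ℝ (range e) :=
  Submodule.sum_mem _ fun i _ => Submodule.smul_mem _ _ (Submodule.subset_span (mem_range_self i))

theorem finrank_span (he : IsLinFlat C e) :
    Module.finrank ℝ (Submodule.span ℝ (range e)) = Fintype.card ι :=
  finrank_span_eq_card he.linearIndependent

variable [FiniteDimensional ℝ E]

theorem span_eq_of_le (he : IsLinFlat C e) (hf : IsLinFlat C f)
    (h : ∀ i, e i ∈ Submodule.span ℝ (range f)) :
    Submodule.span ℝ (range e) = Submodule.span ℝ (range f) := by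
  refine Submodule.eq_of_le_of_finrank_eq (Submodule.span_le.2 ?_) ?_
  · rintro _ ⟨i, rfl⟩
    exact h i
  · rw [he.finrank_span, hf.finrank_span]

theorem map_eq_zero_iff (he : IsLinFlat C e) (hcard : Module.finrank ℝ E = Fintype.card ι + 1)
    {θ : E →L[ℝ] ℝ} (h0 : θ ≠ 0) (hθ : ∀ i, θ (e i) = 0) (x : E) :
    θ x = 0 ↔ x ∈ Submodule.span ℝ (range e) := by
  have hle : Submodule.span ℝ (range e) ≤ LinearMap.ker (θ : E →ₗ[ℝ] ℝ) := by
    refine Submodule.span_le.2 ?_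
    rintro _ ⟨i, rfl⟩
    exact hθ i
  have heq : Submodule.span ℝ (range e) = LinearMap.ker (θ : E →ₗ[ℝ] ℝ) := by
    refine Submodule.eq_of_le_of_finrank_le hle ?_
    have h1 := Module.Dual.finrank_ker_add_one_of_ne_zero (f := (θ : E →ₗ[ℝ] ℝ)) (fun h => h0 (by
      ext x; exact LinearMap.congr_fun h x))
    rw [he.finrank_span]
    omega
  rw [heq]
  rfl

theorem exists_functional (he : IsLinFlat C e)
    (hcard : Module.finrank ℝ E = Fintype.card ι + 1) :
    ∃ θ : E →L[ℝ] ℝ, ‖θ‖ = 1 ∧ ∀ x, θ x = 0 ↔ x ∈ Submodule.span ℝ (range e) := by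
  have hlt : Submodule.span ℝ (range e) < ⊤ := by
    refine lt_top_iff_ne_top.2 fun h => ?_
    have := he.finrank_span
    rw [h, finrank_top] at this
    omega
  obtain ⟨f, hf, hle⟩ := Submodule.exists_le_ker_of_lt_top _ hlt
  set θ : E →L[ℝ] ℝ := LinearMap.toContinuousLinearMap f with hθ
  have hθ0 : θ ≠ 0 := fun h => hf (by
    ext x
    have := congrArg (fun u : E →L[ℝ] ℝ => u x) h
    simpa [hθ] using this)
  have hn : 0 < ‖θ‖ := norm_pos_iff.2 hθ0
  refine ⟨‖θ‖⁻¹ • θ, ?_, fun x => ?_⟩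
  · rw [norm_smul, norm_inv, norm_norm, inv_mul_cancel₀ hn.ne']
  · rw [← he.map_eq_zero_iff hcard hθ0 (fun i => hle (Submodule.subset_span (mem_range_self i)))]
    simp [hn.ne']

end IsLinFlat

end Cone

section Cone

variable {E : Type*} [NormedAddCommGroup E] [NormedSpace ℝ E]

namespace IsLinFlat

variable {ι : Type*} [Fintype ι] {C : Set E} {e f : ι → E}

theorem isFaceDirection_sum (hC : IsSalientCone C) (he : IsLinFlat C e) {c a : ι → ℝ}
    (hc : ∀ i, 0 ≤ c i) (ha : ∀ i, c i = 0 → a i = 0) :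
    IsFaceDirection C (∑ i, c i • e i) (∑ i, a i • e i) := by
  classical
  have hz := he.sum_mem_closure hc
  refine IsFaceDirection.sum hC hz _ fun i _ => ?_
  by_cases h : c i = 0
  · rw [ha i h, zero_smul]
    exact ⟨1, one_pos, by simpa using hz, by simpa using hz⟩
  · have hpos : 0 < c i := (hc i).lt_of_ne' h
    refine IsFaceDirection.smul hz ?_ _
    refine IsFaceDirection.of_sub_mem hC hz (he.mem_closure i) hpos ?_
    have : ∑ j, c j • e j - c i • e i = ∑ j ∈ Finset.univ.erase i, c j • e j := by
      rw [sub_eq_iff_eq_add, Finset.sum_erase_add _ _ (Finset.mem_univ i)]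
    rw [this]
    exact hC.sum_mem_closure _ fun j _ => hC.smul_mem_closure (hc j) (he.mem_closure j)

theorem facet_sum {i : ι} {φ : E →L[ℝ] ℝ} (hφ : ∀ k, k ≠ i → φ (e k) = 0) (c : ι → ℝ) :
    φ (∑ k, c k • e k) = c i * φ (e i) := by
  rw [map_sum, Finset.sum_eq_single i (fun k _ hk => by simp [hφ k hk]) (by simp), map_smul,
    smul_eq_mul]

theorem notMem_span_of_not_isFaceDirection (hC : IsSalientCone C) (he : IsLinFlat C e)
    {c : ι → ℝ} (hc : ∀ i, 0 ≤ c i) {q : E} (hq : q ∈ supportLineality C (∑ i, c i • e i))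
    (hq' : ¬ IsFaceDirection C (∑ i, c i • e i) q) : q ∉ Submodule.span ℝ (range e) := by
  intro hmem
  obtain ⟨a, rfl⟩ := exists_coeff hmem
  refine hq' (he.isFaceDirection_sum hC hc fun i hi => ?_)
  obtain ⟨φ, h1, h2, h3⟩ := he.exists_facet hC i
  have := hq φ h1 (by rw [facet_sum h2, hi, zero_mul])
  rw [facet_sum h2] at this
  exact (mul_eq_zero.1 this).resolve_right h3.ne'

variable [FiniteDimensional ℝ E]

/-- Faces of the cone at boundary points of a flat are spanned by generators of the flat. -/
theorem exists_coeff_of_isFaceDirection (hC : IsDivisibleCone C) (he : IsLinFlat C e)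
    (hcard : Module.finrank ℝ E = Fintype.card ι + 1) {c : ι → ℝ} (hc : ∀ i, 0 ≤ c i)
    (hc0 : ∃ i, c i = 0) {y : E} (hy : IsFaceDirection C (∑ i, c i • e i) y) :
    ∃ b : ι → ℝ, (∀ i, c i = 0 → b i = 0) ∧ y = ∑ i, b i • e i := by
  have hS := hC.toIsSalientCone
  have hz := he.sum_mem_closure hc
  by_cases hz0 : ∑ i, c i • e i = 0
  · obtain ⟨ε, hε, h1, h2⟩ := hy
    rw [hz0, zero_add] at h1
    rw [hz0, zero_sub] at h2
    have := (smul_eq_zero.1 (hS.eq_zero_of_neg_mem h1 h2)).resolve_left hε.ne'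
    exact ⟨0, fun _ _ => rfl, by simp [this]⟩
  obtain ⟨q, hq, hq'⟩ := hC.exists_mem_supportLineality hz (he.sum_notMem c hc hc0) hz0
  replace hq' : ¬ IsFaceDirection C (∑ i, c i • e i) q := fun ⟨ε, h, h'⟩ => hq' ε h h'
  have hqs := he.notMem_span_of_not_isFaceDirection hS hc hq hq'
  obtain ⟨θ, -, hθ⟩ := he.exists_functional hcard
  have hθq : θ q ≠ 0 := fun h => hqs ((hθ q).1 h)
  set α := θ y / θ q with hα
  obtain ⟨b, hb⟩ := exists_coeff ((hθ (y - α • q)).1 (by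
    rw [map_sub, map_smul, smul_eq_mul, hα, div_mul_cancel₀ _ hθq, sub_self]))
  have hb0 : ∀ i, c i = 0 → b i = 0 := by
    intro i hi
    obtain ⟨φ, h1, h2, h3⟩ := he.exists_facet hS i
    have hφz : φ (∑ k, c k • e k) = 0 := by rw [facet_sum h2, hi, zero_mul]
    have h4 := congrArg φ hb
    rw [map_sub, map_smul, hq φ h1 hφz, hy.map_eq_zero h1 hφz, facet_sum h2, smul_zero,
      sub_zero] at h4
    exact (mul_eq_zero.1 h4.symm).resolve_right h3.ne'
  by_cases hα0 : α = 0
  · rw [hα0, zero_smul, sub_zero] at hb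
    exact ⟨b, hb0, hb⟩
  · refine absurd ?_ hq'
    have := (hy.sub hS hz (he.isFaceDirection_sum hS hc hb0)).smul hz α⁻¹
    rwa [← hb, sub_sub_cancel, smul_smul, inv_mul_cancel₀ hα0, one_smul] at this

theorem mem_span_of_boundary_sum_mem_span (hC : IsDivisibleCone C) (he : IsLinFlat C e)
    (hf : IsLinFlat C f) (hcard : Module.finrank ℝ E = Fintype.card ι + 1) {c : ι → ℝ}
    (hc : ∀ i, 0 ≤ c i) (hc0 : ∃ i, c i = 0)
    (hmem : ∑ i, c i • e i ∈ Submodule.span ℝ (range f)) {i : ι} (hi : 0 < c i) :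
    e i ∈ Submodule.span ℝ (range f) := by
  classical
  have hS := hC.toIsSalientCone
  have hz := he.sum_mem_closure hc
  have hzC := he.sum_notMem c hc hc0
  have hdir : IsFaceDirection C (∑ i, c i • e i) (e i) := by
    have := he.isFaceDirection_sum hS hc (a := Pi.single i 1) fun k hk => by
      rw [Pi.single_eq_of_ne]
      rintro rfl
      exact hi.ne' hk
    simpa [Pi.single_apply] using this
  obtain ⟨a, ha⟩ := exists_coeff hmem
  rw [ha] at hz hzC hdir
  have ha0 := hf.coeff_nonneg hS hz
  obtain ⟨b, -, hb⟩ := hf.exists_coeff_of_isFaceDirection hC hcard ha0 (by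
    by_contra! hne
    exact hzC (hf.sum_mem a fun i => (ha0 i).lt_of_ne' (hne i))) hdir
  rw [hb]
  exact sum_mem_span b

/-- Two flats whose hyperplanes meet inside the cone lie in the same hyperplane. -/
theorem span_eq_of_mem (hC : IsDivisibleCone C) (he : IsLinFlat C e) (hf : IsLinFlat C f)
    (hcard : Module.finrank ℝ E = Fintype.card ι + 1) (h3 : 3 ≤ Fintype.card ι) {x : E}
    (hx : x ∈ C) (hxe : x ∈ Submodule.span ℝ (range e))
    (hxf : x ∈ Submodule.span ℝ (range f)) :
    Submodule.span ℝ (range e) = Submodule.span ℝ (range f) := by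
  have hS := hC.toIsSalientCone
  have : Nonempty ι := Fintype.card_pos_iff.1 (by omega)
  obtain ⟨y, ⟨hye, hyf⟩, hyx⟩ : ∃ y ∈ Submodule.span ℝ (range e) ⊓ Submodule.span ℝ (range f),
      y ∉ Submodule.span ℝ {x} := by
    by_contra! hcon
    have h1 := Submodule.finrank_mono (show Submodule.span ℝ (range e) ⊓
      Submodule.span ℝ (range f) ≤ Submodule.span ℝ {x} from hcon)
    have h2 := Submodule.finrank_sup_add_finrank_inf_eq (Submodule.span ℝ (range e))
      (Submodule.span ℝ (range f))
    have h4 := Submodule.finrank_le (Submodule.span ℝ (range e) ⊔ Submodule.span ℝ (range f))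
    have h5 : Module.finrank ℝ (Submodule.span ℝ {x}) ≤ 1 := by
      simpa using finrank_span_le_card (R := ℝ) ({x} : Set E)
    rw [he.finrank_span, hf.finrank_span] at h2
    omega
  obtain ⟨a, rfl⟩ := exists_coeff hxe
  obtain ⟨b, rfl⟩ := exists_coeff hye
  have ha := he.coeff_pos hS hx
  obtain ⟨i₁, h₁⟩ := Finite.exists_min fun i => b i / a i
  obtain ⟨i₂, h₂⟩ := Finite.exists_max fun i => b i / a i
  set m := b i₁ / a i₁ with hm
  set M := b i₂ / a i₂ with hM
  have hlt : m < M := by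
    refine (h₂ i₁).lt_of_ne fun heq => hyx (Submodule.mem_span_singleton.2 ⟨m, ?_⟩)
    rw [Finset.smul_sum]
    refine Finset.sum_congr rfl fun i _ => ?_
    have : b i / a i = m := le_antisymm ((h₂ i).trans_eq heq.symm) (h₁ i)
    rw [smul_smul, ← this, div_mul_cancel₀ _ (ha i).ne']
  refine he.span_eq_of_le hf fun i => ?_
  by_cases hi : b i / a i = m
  · refine mem_span_of_boundary_sum_mem_span hC he hf hcard (c := fun i => M * a i - b i)
      (fun i => ?_) ⟨i₂, ?_⟩ ?_ (i := i) ?_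
    · exact sub_nonneg.2 ((div_le_iff₀ (ha i)).1 (h₂ i))
    · exact sub_eq_zero.2 (div_mul_cancel₀ _ (ha i₂).ne')
    · have := Submodule.sub_mem _ (Submodule.smul_mem _ M hxf) hyf
      convert this using 1
      simp only [sub_smul, Finset.sum_sub_distrib, mul_smul, Finset.smul_sum]
    · exact sub_pos.2 ((div_lt_iff₀ (ha i)).1 (hi.trans_lt hlt))
  · refine mem_span_of_boundary_sum_mem_span hC he hf hcard (c := fun i => b i - m * a i)
      (fun i => ?_) ⟨i₁, ?_⟩ ?_ (i := i) ?_
    · exact sub_nonneg.2 ((le_div_iff₀ (ha i)).1 (h₁ i))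
    · exact sub_eq_zero.2 (div_mul_cancel₀ _ (ha i₁).ne').symm
    · have := Submodule.sub_mem _ hyf (Submodule.smul_mem _ m hxf)
      convert this using 1
      simp only [sub_smul, Finset.sum_sub_distrib, mul_smul, Finset.smul_sum]
    · exact sub_pos.2 ((lt_div_iff₀ (ha i)).1 ((h₁ i).lt_of_ne' hi))

/-- An extremal generator of one flat lying in the hyperplane of another one is, up to scaling,
a generator of that flat. -/
theorem exists_eq_smul_of_mem_span (hC : IsDivisibleCone C) (he : IsLinFlat C e)
    (hf : IsLinFlat C f) (hcard : Module.finrank ℝ E = Fintype.card ι + 1)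
    (h2 : 2 ≤ Fintype.card ι) {k : ι} (hk : e k ∈ Submodule.span ℝ (range f)) :
    ∃ l, ∃ μ : ℝ, 0 < μ ∧ f l = μ • e k := by
  classical
  have hS := hC.toIsSalientCone
  obtain ⟨a, ha⟩ := exists_coeff hk
  have ha0 := hf.coeff_nonneg hS (ha ▸ he.mem_closure k)
  have hek : e k ≠ 0 := he.linearIndependent.ne_zero k
  obtain ⟨l, hl⟩ : ∃ l, a l ≠ 0 := by
    by_contra! h
    exact hek (by rw [ha]; simp [h])
  have hl0 : 0 < a l := (ha0 l).lt_of_ne' hl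
  have hsingle : ∑ j, (Pi.single k 1 : ι → ℝ) j • e j = e k := by simp [Pi.single_apply]
  have hdir : IsFaceDirection C (∑ j, (Pi.single k 1 : ι → ℝ) j • e j) (f l) := by
    have := hf.isFaceDirection_sum hS ha0 (a := Pi.single l 1) fun j hj => by
      rw [Pi.single_eq_of_ne]
      rintro rfl
      exact hl hj
    rw [← ha] at this
    rw [hsingle]
    simpa [Pi.single_apply] using this
  have hnt : Nontrivial ι := Fintype.one_lt_card_iff_nontrivial.1 (by omega)
  obtain ⟨j, hj⟩ := exists_ne k
  obtain ⟨b, hb0, hb⟩ := he.exists_coeff_of_isFaceDirection hC hcard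
    (fun i => by by_cases h : i = k <;> simp [h])
    ⟨j, by simp [hj]⟩ hdir
  have hbk : f l = b k • e k := by
    rw [hb]
    refine Finset.sum_eq_single k (fun i _ hi => ?_) (by simp)
    rw [hb0 i (by simp [hi]), zero_smul]
  refine ⟨l, b k, ?_, hbk⟩
  have h1 : 0 ≤ b k := he.coeff_nonneg hS (c := b) (hb ▸ hf.mem_closure l) k
  refine h1.lt_of_ne fun h => hf.linearIndependent.ne_zero l ?_
  rw [hbk, ← h, zero_smul]

/-- Two flats in different hyperplanes do not share a facet. -/
theorem span_eq_of_facet_mem (hC : IsDivisibleCone C) (he : IsLinFlat C e) (hf : IsLinFlat C f)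
    (hcard : Module.finrank ℝ E = Fintype.card ι + 1) (h3 : 3 ≤ Fintype.card ι) (o : ι)
    (h : ∀ k, k ≠ o → e k ∈ Submodule.span ℝ (range f)) :
    Submodule.span ℝ (range e) = Submodule.span ℝ (range f) := by
  classical
  by_contra hne
  have hS := hC.toIsSalientCone
  have hex : ∀ k, ∃ l, ∃ μ : ℝ, k ≠ o → 0 < μ ∧ f l = μ • e k := fun k => by
    by_cases hk : k = o
    · exact ⟨k, 1, fun h => absurd hk h⟩
    · obtain ⟨l, μ, h⟩ := exists_eq_smul_of_mem_span hC he hf hcard (by omega) (h k hk)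
      exact ⟨l, μ, fun _ => h⟩
  choose π μ hπ using hex
  obtain ⟨m, hm⟩ : ∃ m, f m ∉ Submodule.span ℝ (range e) := by
    by_contra! hall
    exact hne (hf.span_eq_of_le he hall).symm
  have hmem : ∀ k, e k ∈ Submodule.span ℝ (range e) := fun k =>
    Submodule.subset_span (mem_range_self k)
  have hπm : ∀ k, k ≠ o → m ≠ π k := by
    rintro k hk rfl
    rw [(hπ k hk).2] at hm
    exact hm (Submodule.smul_mem _ _ (hmem k))
  have hπinj : ∀ k k', k ≠ o → k' ≠ o → k' ≠ k → π k' ≠ π k := by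
    intro k k' hk hk' hkk heq
    have h1 := (hπ k hk).2
    rw [← heq, (hπ k' hk').2] at h1
    obtain ⟨φ, -, h2, h3⟩ := he.exists_facet hS k
    have h4 := congrArg φ h1
    rw [map_smul, map_smul, h2 k' hkk, smul_zero, smul_eq_mul] at h4
    exact (mul_pos (hπ k hk).1 h3).ne h4
  obtain ⟨i, t, hio, hto, hit⟩ : ∃ i t : ι, i ≠ o ∧ t ≠ o ∧ i ≠ t := by
    obtain ⟨i, hi⟩ := (Finset.one_lt_card (s := Finset.univ.erase o)).1 (by
      rw [Finset.card_erase_of_mem (Finset.mem_univ o), Finset.card_univ]; omega)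
    obtain ⟨hi, t, ht, hit⟩ := hi
    exact ⟨i, t, Finset.ne_of_mem_erase hi, Finset.ne_of_mem_erase ht, hit⟩
  obtain ⟨φ, hφ1, hφ2, hφ3⟩ := he.exists_facet hS i
  obtain ⟨ψ, hψ1, hψ2, hψ3⟩ := he.exists_facet hS o
  obtain ⟨φ', hφ1', hφ2', hφ3'⟩ := hf.exists_facet hS (π i)
  have hφe : ∀ k, k ≠ o → k ≠ i → φ' (e k) = 0 := by
    intro k hk hki
    have h1 := hφ2' _ (hπinj i k hio hk hki)
    rw [(hπ k hk).2, map_smul, smul_eq_mul] at h1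
    exact (mul_eq_zero.1 h1).resolve_left (hπ k hk).1.ne'
  have hφi : 0 < φ' (e i) := by
    have h1 := hφ3'
    rw [(hπ i hio).2, map_smul, smul_eq_mul] at h1
    exact (pos_iff_pos_of_mul_pos h1).1 (hπ i hio).1
  set c : ι → ℝ := fun k => if k = i ∨ k = o then 0 else 1 with hcdef
  have hc : ∀ k, 0 ≤ c k := fun k => by simp only [hcdef]; split_ifs <;> norm_num
  have hci : c i = 0 := by simp [hcdef]
  have hco : c o = 0 := by simp [hcdef]
  have hz0 : ∑ k, c k • e k ≠ 0 := by
    intro h0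
    have := Fintype.linearIndependent_iff.1 he.linearIndependent c h0 t
    simp [hcdef, hto, hit.symm] at this
  obtain ⟨q, hq, hq'⟩ := hC.exists_mem_supportLineality (he.sum_mem_closure hc)
    (he.sum_notMem c hc ⟨i, hci⟩) hz0
  have hqs := he.notMem_span_of_not_isFaceDirection hS hc hq fun ⟨ε, h, h'⟩ => hq' ε h h'
  have hφ'z : φ' (∑ k, c k • e k) = 0 := by
    rw [map_sum]
    refine Finset.sum_eq_zero fun k _ => ?_
    by_cases hk : k = i ∨ k = o
    · simp [hcdef, hk]
    · rw [map_smul, hφe k (fun h => hk (Or.inr h)) (fun h => hk (Or.inl h)), smul_zero]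
  have hφq := hq φ hφ1 (by rw [facet_sum hφ2, hci, zero_mul])
  have hψq := hq ψ hψ1 (by rw [facet_sum hψ2, hco, zero_mul])
  have hφq' := hq φ' hφ1' hφ'z
  obtain ⟨θ, -, hθ⟩ := he.exists_functional hcard
  have hθq : θ q ≠ 0 := fun h => hqs ((hθ q).1 h)
  set α := φ' (e i) / φ (e i) with hα
  set β := φ' (e o) / ψ (e o) with hβ
  have hcomb : ∀ x, φ' x = α * φ x + β * ψ x := by
    intro x
    obtain ⟨b, hb⟩ := exists_coeff ((hθ (x - (θ x / θ q) • q)).1 (by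
      rw [map_sub, map_smul, smul_eq_mul, div_mul_cancel₀ _ hθq, sub_self]))
    have hx : x = ∑ k, b k • e k + (θ x / θ q) • q := by rw [← hb, sub_add_cancel]
    have hb' : φ' (∑ k, b k • e k) = b i * φ' (e i) + b o * φ' (e o) := by
      rw [map_sum, ← Finset.add_sum_erase _ _ (Finset.mem_univ i),
        ← Finset.add_sum_erase (Finset.univ.erase i) _
          (Finset.mem_erase.2 ⟨hio.symm, Finset.mem_univ o⟩), Finset.sum_eq_zero, add_zero]
      · simp
      · intro k hk
        rw [Finset.mem_erase, Finset.mem_erase] at hk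
        rw [map_smul, hφe k hk.1 hk.2.1, smul_zero]
    rw [hx]
    simp only [map_add, map_smul, hφq, hψq, hφq', facet_sum hφ2, facet_sum hψ2, hb', smul_zero,
      add_zero]
    rw [hα, hβ]
    field_simp
  have hφw : φ (f m) = 0 := by
    have h1 := hcomb (f m)
    rw [hφ2' m (hπm i hio)] at h1
    have h2 : 0 ≤ β * ψ (f m) := mul_nonneg (div_nonneg (hφ1' _ (he.mem_closure o)) hψ3.le)
      (hψ1 _ (hf.mem_closure m))
    have h4 : 0 < α := div_pos hφi hφ3
    have h5 := hφ1 _ (hf.mem_closure m)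
    nlinarith
  set a : ι → ℝ := fun k => if k = i then 0 else 1 with hadef
  have ha : ∀ k, 0 ≤ a k := fun k => by simp only [hadef]; split_ifs <;> norm_num
  have hai : a i = 0 := by simp [hadef]
  set y := ∑ k, a k • e k + f m with hy
  have hacl := he.sum_mem_closure ha
  have hycl : y ∈ closure C := hS.add_mem_closure hacl (hf.mem_closure m)
  have hφy : φ y = 0 := by rw [hy, map_add, facet_sum hφ2, hai, zero_mul, hφw, add_zero]
  have hyC : y ∉ C := by
    intro hyC
    obtain ⟨M, hM, hMy⟩ := hS.exists_smul_sub_mem isCompact_singleton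
      (singleton_subset_iff.2 hyC) (e i)
    have h1 := hφ1 _ (subset_closure (hMy y rfl))
    rw [map_sub, map_smul, hφy, smul_zero] at h1
    linarith
  have hy0 : y ≠ 0 := by
    intro h0
    refine hm ?_
    rw [eq_neg_of_add_eq_zero_right h0]
    exact Submodule.neg_mem _ (sum_mem_span a)
  obtain ⟨r, hr, hr'⟩ := hC.exists_mem_supportLineality hycl hyC hy0
  have hθw : θ (f m) ≠ 0 := fun h => hm ((hθ _).1 h)
  obtain ⟨b, hb⟩ := exists_coeff ((hθ (r - (θ r / θ (f m)) • f m)).1 (by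
    rw [map_sub, map_smul, smul_eq_mul, div_mul_cancel₀ _ hθw, sub_self]))
  have hbi : b i = 0 := by
    have h1 := congrArg φ hb
    rw [map_sub, map_smul, hφw, hr φ hφ1 hφy, facet_sum hφ2, smul_zero, sub_zero] at h1
    exact (mul_eq_zero.1 h1.symm).resolve_right hφ3.ne'
  have hdir : IsFaceDirection C y r := by
    have hr2 : r = ∑ k, b k • e k + (θ r / θ (f m)) • f m := by rw [← hb, sub_add_cancel]
    rw [hr2]
    refine IsFaceDirection.add hS hycl ?_ (IsFaceDirection.smul hycl ?_ _)
    · obtain ⟨ε, hε, h1, h2⟩ := he.isFaceDirection_sum hS ha (a := b) fun k hk => by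
        have : k = i := by
          by_contra hki
          simp [hadef, hki] at hk
        rw [this, hbi]
      refine ⟨ε, hε, ?_, ?_⟩
      · rw [hy, add_right_comm]
        exact hS.add_mem_closure h1 (hf.mem_closure m)
      · rw [hy, add_sub_right_comm]
        exact hS.add_mem_closure h2 (hf.mem_closure m)
    · refine IsFaceDirection.of_sub_mem hS hycl (hf.mem_closure m) one_pos ?_
      rw [hy, one_smul, add_sub_cancel_right]
      exact hacl
  obtain ⟨ε, hε, h1, h2⟩ := hdir
  exact hr' ε hε ⟨h1, h2⟩

end IsLinFlat

end Cone

section Cone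

variable {E : Type*} [NormedAddCommGroup E] [NormedSpace ℝ E]

theorem tendsto_functional_apply {U : Filter ℕ} {θ : ℕ → E →L[ℝ] ℝ} {θ₀ : E →L[ℝ] ℝ} {x : ℕ → E}
    {x₀ : E} (hθ : Tendsto θ U (𝓝 θ₀)) (hx : Tendsto x U (𝓝 x₀)) :
    Tendsto (fun n => θ n (x n)) U (𝓝 (θ₀ x₀)) :=
  ((isBoundedBilinearMap_apply (𝕜 := ℝ) (E := E) (F := ℝ)).continuous.tendsto (θ₀, x₀)).comp
    (hθ.prodMk_nhds hx)

/-- The kernel of `θ` contains a point comparable to `x` within a factor two. -/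
def IsNearKer (C : Set E) (θ : E →L[ℝ] ℝ) (x : E) : Prop :=
  ∃ y, θ y = 0 ∧ (2 : ℝ) • y - x ∈ closure C ∧ (2 : ℝ) • x - y ∈ closure C

theorem eventually_isNearKer {C : Set E} (hC : IsSalientCone C) {U : Filter ℕ}
    {θ : ℕ → E →L[ℝ] ℝ} {θ₀ : E →L[ℝ] ℝ} (hθ : Tendsto θ U (𝓝 θ₀)) (h0 : θ₀ ≠ 0) {x : ℕ → E}
    {x₀ : E} (hx : Tendsto x U (𝓝 x₀)) (hx₀ : x₀ ∈ C) (hθx : θ₀ x₀ = 0) :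
    ∀ᶠ n in U, IsNearKer C (θ n) (x n) := by
  obtain ⟨u, hu⟩ : ∃ u, θ₀ u ≠ 0 := by
    by_contra! h
    exact h0 (by ext u; simpa using h u)
  have hθu : Tendsto (fun n => θ n u) U (𝓝 (θ₀ u)) := 
    tendsto_functional_apply hθ tendsto_const_nhds
  have hy : Tendsto (fun n => x n - (θ n (x n) / θ n u) • u) U (𝓝 x₀) := by
    have := hx.sub (((tendsto_functional_apply hθ hx).div hθu hu).smul_const u)
    simpa [hθx] using this
  have h1 : Tendsto (fun n => (2 : ℝ) • (x n - (θ n (x n) / θ n u) • u) - x n) U (𝓝 x₀) := by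
    have := (hy.const_smul (2 : ℝ)).sub hx
    rwa [two_smul, add_sub_cancel_right] at this
  have h2 : Tendsto (fun n => (2 : ℝ) • x n - (x n - (θ n (x n) / θ n u) • u)) U (𝓝 x₀) := by
    have := (hx.const_smul (2 : ℝ)).sub hy
    rwa [two_smul, add_sub_cancel_right] at this
  have hnhds := hC.isOpen.mem_nhds hx₀
  filter_upwards [h1.eventually hnhds, h2.eventually hnhds, hθu.eventually_ne hu] with n h3 h4 h5
  refine ⟨_, ?_, subset_closure h3, subset_closure h4⟩
  rw [map_sub, map_smul, smul_eq_mul, div_mul_cancel₀ _ h5, sub_self]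

theorem IsNearKer.smul_comp_symm {C : Set E} {θ : E →L[ℝ] ℝ} {x : E} {g : E ≃L[ℝ] E}
    (hg : g '' C = C) {r : ℝ} (hr : r ≠ 0)
    (h : IsNearKer C (r • θ.comp (g.symm : E →L[ℝ] E)) (g x)) : IsNearKer C θ x := by
  obtain ⟨y, h1, h2, h3⟩ := h
  have h2' := mem_closure_of_image_eq (symm_image_eq hg) h2
  have h3' := mem_closure_of_image_eq (symm_image_eq hg) h3
  refine ⟨g.symm y, by simpa [hr] using h1, by simpa using h2', by simpa using h3'⟩

variable [FiniteDimensional ℝ E]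

namespace IsLinFlat

variable {ι : Type*} [Fintype ι] {C : Set E} {e f : ι → E}

theorem exists_tendsto_of_norm_sum_le (hC : IsSalientCone C) {U : Ultrafilter ℕ}
    {f : ℕ → ι → E} {R : ℝ} (hf : ∀ᶠ n in (U : Filter ℕ), IsLinFlat C (f n))
    (hR : ∀ᶠ n in (U : Filter ℕ), ‖∑ i, f n i‖ ≤ R) :
    ∃ e : ι → E, ∀ i, Tendsto (fun n => f n i) U (𝓝 (e i)) := by
  classical
  obtain ⟨ℓ, hℓ⟩ := hC.exists_norm_le
  have : ∀ i, ∃ a, Tendsto (fun n => f n i) U (𝓝 a) := fun i => by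
    refine exists_tendsto_of_norm_le U (R := ‖ℓ‖ * R) ?_
    filter_upwards [hf, hR] with n h1 h2
    have h3 := hℓ _ (h1.mem_closure i)
    have h4 := (norm_nonneg _).trans (hℓ _ (hC.sum_mem_closure (Finset.univ.erase i)
      fun k _ => h1.mem_closure k))
    have h5 : ℓ (∑ k, f n k) ≤ ‖ℓ‖ * R := (le_abs_self _).trans
      ((ℓ.le_opNorm _).trans (mul_le_mul_of_nonneg_left h2 (norm_nonneg _)))
    rw [← Finset.add_sum_erase _ _ (Finset.mem_univ i), map_add] at h5
    linarith
  choose e he using this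
  exact ⟨e, he⟩

theorem exists_nonneg_functional (hC : IsDivisibleCone C) (he : IsLinFlat C e)
    (hf : IsLinFlat C f) (hcard : Module.finrank ℝ E = Fintype.card ι + 1)
    (h3 : 3 ≤ Fintype.card ι)
    (hne : Submodule.span ℝ (range f) ≠ Submodule.span ℝ (range e)) :
    ∃ θ : E →L[ℝ] ℝ, ‖θ‖ = 1 ∧ (∀ x, θ x = 0 ↔ x ∈ Submodule.span ℝ (range f)) ∧
      ∀ i, 0 ≤ θ (e i) := by
  classical
  obtain ⟨θ, h1, hθ⟩ := hf.exists_functional hcard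
  have hsum : ∀ c : ι → ℝ, (∀ i, 0 < c i) → θ (∑ i, c i • e i) ≠ 0 := fun c hc h0 =>
    hne (span_eq_of_mem hC he hf hcard h3 (he.sum_mem c hc) (sum_mem_span c) ((hθ _).1 h0)).symm
  have key : ∀ θ' : E →L[ℝ] ℝ, (∀ c : ι → ℝ, (∀ i, 0 < c i) → θ' (∑ i, c i • e i) ≠ 0) →
      0 < θ' (∑ i, (1 : ℝ) • e i) → ∀ i, 0 ≤ θ' (e i) := by
    intro θ' hs hpos i
    by_contra! hi
    have ht : 0 < -(θ' (∑ i, (1 : ℝ) • e i) / θ' (e i)) := neg_pos.2 (div_neg_of_pos_of_neg hpos hi)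
    refine hs (fun k => 1 + Pi.single (M := fun _ => ℝ) i
      (-(θ' (∑ i, (1 : ℝ) • e i) / θ' (e i))) k) (fun k => ?_) ?_
    · by_cases hk : k = i
      · subst hk
        rw [Pi.single_eq_same]
        linarith
      · simp [hk]
    · simp only [add_smul, Finset.sum_add_distrib, map_add, Pi.single_apply, ite_smul, zero_smul,
        Finset.sum_ite_eq', Finset.mem_univ, if_true, map_smul, smul_eq_mul]
      rw [neg_mul, div_mul_cancel₀ _ hi.ne, add_neg_cancel]
  rcases (hsum (fun _ => 1) fun _ => one_pos).lt_or_gt with h | h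
  · refine ⟨-θ, by rwa [norm_neg], fun x => by rw [← hθ]; simp, key (-θ) (fun c hc => ?_) ?_⟩
    · simpa using hsum c hc
    · simpa using h
  · exact ⟨θ, h1, hθ, key θ hsum h⟩

theorem exists_not_isNearKer [DecidableEq ι] (hC : IsDivisibleCone C) (he : IsLinFlat C e)
    (hcard : Module.finrank ℝ E = Fintype.card ι + 1) (h2 : 2 ≤ Fintype.card ι)
    {θ : E →L[ℝ] ℝ} {j : ι} (hj : 0 < θ (e j)) :
    ∃ m : ℕ, ¬ IsNearKer C θ (∑ i, (if i = j then (1 : ℝ) else (1 / 2) ^ m) • e i) := by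
  by_contra! hcon
  have hS := hC.toIsSalientCone
  obtain ⟨ℓ, hℓ⟩ := hS.exists_norm_le
  let U : Ultrafilter ℕ := hyperfilter ℕ
  have hU : (U : Filter ℕ) ≤ atTop := Nat.hyperfilter_le_atTop
  choose y hy0 hy1 hy2 using hcon
  have hpow : Tendsto (fun m : ℕ => ((1 : ℝ) / 2) ^ m) U (𝓝 0) :=
    (tendsto_pow_atTop_nhds_zero_of_lt_one (by norm_num) (by norm_num)).mono_left hU
  set x : ℕ → E := fun m => ∑ i, (if i = j then (1 : ℝ) else (1 / 2) ^ m) • e i with hx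
  have hxlim : Tendsto x U (𝓝 (e j)) := by
    have : Tendsto x U (𝓝 (∑ i, (if i = j then (1 : ℝ) else 0) • e i)) := by
      refine tendsto_finsetSum _ fun i _ => Tendsto.smul_const ?_ _
      split_ifs
      exacts [tendsto_const_nhds, hpow]
    simpa using this
  have hxcl : ∀ m, x m ∈ closure C := fun m => he.sum_mem_closure fun i => by
    split_ifs <;> positivity
  have hycl : ∀ m, y m ∈ closure C := fun m => by
    have := hS.smul_mem_closure (t := 1 / 2) (by norm_num)
      (hS.add_mem_closure (hy1 m) (hxcl m))
    rwa [sub_add_cancel, smul_smul, show (1 / 2 : ℝ) * 2 = 1 by norm_num, one_smul] at this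
  obtain ⟨y₀, hy₀⟩ : ∃ a, Tendsto y U (𝓝 a) := by
    refine exists_tendsto_of_norm_le U (R := 2 * (ℓ (e j) + 1)) ?_
    have hl : Tendsto (fun m => ℓ (x m)) U (𝓝 (ℓ (e j))) := (ℓ.continuous.tendsto _).comp hxlim
    filter_upwards [hl.eventually (gt_mem_nhds (lt_add_one _))] with m hm
    have h1 := hℓ _ (hycl m)
    have h4 := (norm_nonneg _).trans (hℓ _ (hy2 m))
    simp only [map_sub, map_smul, smul_eq_mul] at h4
    change ℓ (x m) < _ at hm
    change 0 ≤ 2 * ℓ (x m) - _ at h4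
    linarith
  have hy₀cl : y₀ ∈ closure C := isClosed_closure.mem_of_tendsto hy₀ (Eventually.of_forall hycl)
  have h4 : (2 : ℝ) • y₀ - e j ∈ closure C := isClosed_closure.mem_of_tendsto
    ((hy₀.const_smul (2 : ℝ)).sub hxlim) (Eventually.of_forall hy1)
  have h5 : (2 : ℝ) • e j - y₀ ∈ closure C := isClosed_closure.mem_of_tendsto
    ((hxlim.const_smul (2 : ℝ)).sub hy₀) (Eventually.of_forall hy2)
  have hθy : θ y₀ = 0 := tendsto_nhds_unique ((θ.continuous.tendsto _).comp hy₀)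
    (tendsto_const_nhds.congr fun m => (hy0 m).symm)
  have hnt : Nontrivial ι := Fintype.one_lt_card_iff_nontrivial.1 (by omega)
  obtain ⟨k, hk⟩ := exists_ne j
  have hsingle : ∑ i, (Pi.single j 1 : ι → ℝ) i • e i = e j := by simp [Pi.single_apply]
  have hdir : IsFaceDirection C (∑ i, (Pi.single j 1 : ι → ℝ) i • e i) y₀ := by
    rw [hsingle]
    refine IsFaceDirection.of_sub_mem hS (he.mem_closure j) hy₀cl (ε := 1 / 2) (by norm_num) ?_
    have := hS.smul_mem_closure (t := 1 / 2) (by norm_num) h5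
    rwa [smul_sub, smul_smul, show (1 / 2 : ℝ) * 2 = 1 by norm_num, one_smul] at this
  obtain ⟨b, hb0, hb⟩ := he.exists_coeff_of_isFaceDirection hC hcard
    (fun i => by by_cases h : i = j <;> simp [h]) ⟨k, by simp [hk]⟩ hdir
  have hbj : y₀ = b j • e j := by
    rw [hb]
    refine Finset.sum_eq_single j (fun i _ hi => ?_) (by simp)
    rw [hb0 i (by simp [hi]), zero_smul]
  have hbj0 : b j = 0 := by
    rw [hbj, map_smul, smul_eq_mul] at hθy
    exact (mul_eq_zero.1 hθy).resolve_right hj.ne'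
  rw [hbj, hbj0, zero_smul, smul_zero, zero_sub] at h4
  exact he.linearIndependent.ne_zero j (hS.eq_zero_of_neg_mem (he.mem_closure j) h4)

end IsLinFlat

end Cone

section Cone

variable {E : Type*} [NormedAddCommGroup E] [NormedSpace ℝ E] [FiniteDimensional ℝ E]

namespace IsLinFlat

variable {ι : Type*} [Fintype ι] {C : Set E} {e : ι → E}

/-- Flats are isolated: a sequence of flats converging to a flat is eventually constant. -/
theorem eventually_span_eq (hC : IsDivisibleCone C) (he : IsLinFlat C e)
    (hcard : Module.finrank ℝ E = Fintype.card ι + 1) (h3 : 3 ≤ Fintype.card ι)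
    {U : Ultrafilter ℕ} {f : ℕ → ι → E} (hf : ∀ n, IsLinFlat C (f n))
    (hlim : ∀ i, Tendsto (fun n => f n i) U (𝓝 (e i))) :
    ∀ᶠ n in (U : Filter ℕ), Submodule.span ℝ (range (f n)) = Submodule.span ℝ (range e) := by
  classical
  by_contra hcon
  rw [← Ultrafilter.eventually_not] at hcon
  have hS := hC.toIsSalientCone
  have hne : Nonempty ι := Fintype.card_pos_iff.1 (by omega)
  obtain ⟨η, hη⟩ := (hcon.mono fun n hn =>
    exists_nonneg_functional hC he (hf n) hcard h3 hn).choice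
  have hmax : ∀ n, ∃ j, ∀ i, η n (e i) ≤ η n (e j) := fun n => Finite.exists_max _
  choose jmax hjmax using hmax
  obtain ⟨j, hj⟩ := (U.map jmax).eq_pure_of_finite
  have hjU : ∀ᶠ n in (U : Filter ℕ), jmax n = j := by
    have : ({j} : Set ι) ∈ U.map jmax := by rw [hj]; exact Ultrafilter.mem_pure.2 rfl
    exact this
  obtain ⟨η₀, hη₀⟩ := exists_tendsto_of_norm_le U (f := η) (hη.mono fun n hn => hn.1.le)
  have hη₀1 : ‖η₀‖ = 1 := tendsto_nhds_unique
    (hη₀.norm.congr' (hη.mono fun n hn => hn.1)) tendsto_const_nhds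
  have hη₀0 : η₀ ≠ 0 := norm_ne_zero_iff.1 (by rw [hη₀1]; exact one_ne_zero)
  have hη₀e : ∀ i, η₀ (e i) = 0 := fun i => by
    refine tendsto_nhds_unique (tendsto_functional_apply hη₀ (hlim i)) ?_
    refine tendsto_const_nhds.congr' ?_
    filter_upwards [hη] with n hn
    exact ((hn.2.1 _).2 (Submodule.subset_span (mem_range_self i))).symm
  set w : ℝ → ι → ℝ := fun s i => if i = j then 1 else s with hw
  have hwpos : ∀ s, 0 < s → ∀ i, 0 < w s i := fun s hs i => by
    simp only [hw]
    split_ifs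
    exacts [one_pos, hs]
  set x : ℝ → E := fun s => ∑ i, w s i • e i with hx
  have hxC : ∀ s, 0 < s → x s ∈ C := fun s hs => he.sum_mem _ (hwpos s hs)
  have hpow : ∀ m : ℕ, (0 : ℝ) < (1 / 2) ^ m := fun m => by positivity
  have hnear : ∀ m : ℕ, ∀ᶠ n in (U : Filter ℕ), IsNearKer C (η n) (x ((1 / 2) ^ m)) := fun m =>
    eventually_isNearKer hS hη₀ hη₀0 tendsto_const_nhds (hxC _ (hpow m)) (by simp [hx, hη₀e])
  have hfail : ∀ᶠ n in (U : Filter ℕ), ∃ m : ℕ, IsNearKer C (η n) (x ((1 / 2) ^ m)) ∧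
      (∀ k ≤ m, IsNearKer C (η n) (x ((1 / 2) ^ k))) ∧
      ¬ IsNearKer C (η n) (x ((1 / 2) ^ (m + 1))) := by
    filter_upwards [hη, hcon, hjU, hnear 0] with n h1 h2 h4 h5
    have hpos : 0 < η n (e j) := by
      refine (h1.2.2 j).lt_of_ne fun h0 => h2 ?_
      refine (he.span_eq_of_le (hf n) fun i => (h1.2.1 _).1 ?_).symm
      have := hjmax n i
      rw [h4, ← h0] at this
      exact le_antisymm this (h1.2.2 i)
    have hex : ∃ m : ℕ, ¬ IsNearKer C (η n) (x ((1 / 2) ^ m)) :=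
      he.exists_not_isNearKer hC hcard (by omega) hpos
    have hfind := Nat.find_spec hex
    obtain ⟨m, hm⟩ : ∃ m, Nat.find hex = m + 1 := Nat.exists_eq_succ_of_ne_zero fun h0 => by
      rw [h0] at hfind
      exact hfind h5
    have hlt : ∀ k ≤ m, IsNearKer C (η n) (x ((1 / 2) ^ k)) := fun k hk =>
      not_not.1 (Nat.find_min hex (by omega))
    exact ⟨m, hlt m le_rfl, hlt, hm ▸ hfind⟩
  obtain ⟨m, hm⟩ := hfail.choice
  have hmlim : Tendsto m U atTop := by
    refine tendsto_atTop.2 fun B => ?_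
    filter_upwards [(Filter.eventually_all_finset (Finset.range (B + 1))).2 fun k _ => hnear k,
      hm] with n h1 h2
    by_contra! hlt
    exact h2.2.2 (h1 (m n + 1) (Finset.mem_range.2 (by omega)))
  set s : ℕ → ℝ := fun n => (1 / 2) ^ m n with hs
  have hspos : ∀ n, 0 < s n := fun n => hpow _
  have hslim : Tendsto s U (𝓝 0) :=
    (tendsto_pow_atTop_nhds_zero_of_lt_one (by norm_num) (by norm_num)).comp hmlim
  obtain ⟨K, hKC, hK, hcov⟩ := hC.cocompact
  choose g hgC hgK using fun n => hcov _ (hxC (s n) (hspos n))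
  obtain ⟨R, hR⟩ := hK.isBounded.exists_norm_le
  obtain ⟨ℓ, hℓ⟩ := hS.exists_norm_le
  set a : ℕ → ι → E := fun n i => g n (w (s n) i • e i) with ha
  have haflat : ∀ n, IsLinFlat C (a n) := fun n =>
    (he.smul (hwpos _ (hspos n))).map (hgC n)
  have hasum : ∀ n, ∑ i, a n i = g n (x (s n)) := fun n => by simp [ha, hx, map_sum]
  obtain ⟨a₀, ha₀⟩ := exists_tendsto_of_norm_sum_le hS (U := U) (Eventually.of_forall haflat)
    (Eventually.of_forall fun n => by rw [hasum]; exact hR _ (hgK n))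
  have hsumlim : Tendsto (fun n => ∑ i, a n i) U (𝓝 (∑ i, a₀ i)) :=
    tendsto_finsetSum _ fun i _ => ha₀ i
  have ha₀C : ∑ i, a₀ i ∈ C := hKC (hK.isClosed.mem_of_tendsto hsumlim
    (Eventually.of_forall fun n => by rw [hasum]; exact hgK n))
  have ha₀flat := of_tendsto hS (U := U) (Eventually.of_forall haflat) ha₀ ha₀C
  have hbex : ∀ᶠ n in (U : Filter ℕ), ∃ b : ι → E, IsLinFlat C b ∧
      (∀ i, η n ((g n).symm (b i)) = 0) ∧ (2 : ℝ) • ∑ i, b i - ∑ i, a n i ∈ closure C ∧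
      (2 : ℝ) • ∑ i, a n i - ∑ i, b i ∈ closure C := by
    filter_upwards [hm, hη] with n h1 h2
    obtain ⟨y, hy0, hy1, hy2⟩ := h1.1
    obtain ⟨c, hc⟩ := exists_coeff ((h2.2.1 y).1 hy0)
    have hyC : y ∈ C := by
      have := hS.smul_mem (1 / 2) (by norm_num) _ (hS.add_mem (hxC (s n) (hspos n)) hy1)
      rwa [add_sub_cancel, smul_smul, show (1 / 2 : ℝ) * 2 = 1 by norm_num, one_smul] at this
    have hcpos := (hf n).coeff_pos hS (hc ▸ hyC)
    have hsum : ∑ i, g n (c i • f n i) = g n y := by rw [hc, map_sum]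
    refine ⟨fun i => g n (c i • f n i), ((hf n).smul hcpos).map (hgC n), fun i => ?_, ?_, ?_⟩
    · rw [ContinuousLinearEquiv.symm_apply_apply, map_smul,
        (h2.2.1 _).2 (Submodule.subset_span (mem_range_self i)), smul_zero]
    · rw [hsum, hasum, ← map_smul, ← map_sub]
      exact mem_closure_of_image_eq (hgC n) hy1
    · rw [hsum, hasum, ← map_smul, ← map_sub]
      exact mem_closure_of_image_eq (hgC n) hy2
  obtain ⟨b, hb⟩ := hbex.choice
  obtain ⟨b₀, hb₀⟩ := exists_tendsto_of_norm_sum_le hS (U := U) (R := 2 * (‖ℓ‖ * R))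
    (hb.mono fun n h => h.1) (by
      filter_upwards [hb] with n h
      have h1 := hℓ _ (hS.sum_mem_closure Finset.univ fun i _ => h.1.mem_closure i)
      have h2 := (norm_nonneg _).trans (hℓ _ h.2.2.2)
      rw [map_sub, map_smul, smul_eq_mul] at h2
      have h4 : ℓ (∑ i, a n i) ≤ ‖ℓ‖ * R := (le_abs_self _).trans
        ((ℓ.le_opNorm _).trans (mul_le_mul_of_nonneg_left
          (by rw [hasum]; exact hR _ (hgK n)) (norm_nonneg _)))
      linarith)
  have hbsumlim : Tendsto (fun n => ∑ i, b n i) U (𝓝 (∑ i, b₀ i)) :=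
    tendsto_finsetSum _ fun i _ => hb₀ i
  have hb₀C : ∑ i, b₀ i ∈ C := by
    have h1 : (2 : ℝ) • ∑ i, b₀ i - ∑ i, a₀ i ∈ closure C := isClosed_closure.mem_of_tendsto
      ((hbsumlim.const_smul (2 : ℝ)).sub hsumlim) (hb.mono fun n h => h.2.2.1)
    have := hS.smul_mem (1 / 2) (by norm_num) _ (hS.add_mem ha₀C h1)
    rwa [add_sub_cancel, smul_smul, show (1 / 2 : ℝ) * 2 = 1 by norm_num, one_smul] at this
  have hb₀flat := of_tendsto hS (U := U) (hb.mono fun n h => h.1) hb₀ hb₀C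
  set r : ℕ → ℝ := fun n => ‖(η n).comp ((g n).symm : E →L[ℝ] E)‖⁻¹ with hr
  set θ : ℕ → E →L[ℝ] ℝ := fun n => r n • (η n).comp ((g n).symm : E →L[ℝ] E) with hθ
  have hrpos : ∀ᶠ n in (U : Filter ℕ), 0 < r n := by
    filter_upwards [hη] with n hn
    refine inv_pos.2 (norm_pos_iff.2 fun h0 => ?_)
    have : η n = 0 := by
      ext y
      have := congrArg (fun u : E →L[ℝ] ℝ => u (g n y)) h0
      simpa using this
    rw [this, norm_zero] at hn
    exact zero_ne_one hn.1
  have hθ1 : ∀ᶠ n in (U : Filter ℕ), ‖θ n‖ = 1 := by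
    filter_upwards [hrpos] with n hn
    rw [hθ, norm_smul, Real.norm_eq_abs, abs_of_pos hn]
    exact inv_mul_cancel₀ (inv_pos.1 hn).ne'
  obtain ⟨θ₀, hθ₀⟩ := exists_tendsto_of_norm_le U (f := θ) (hθ1.mono fun n hn => hn.le)
  have hθ₀1 : ‖θ₀‖ = 1 := tendsto_nhds_unique (hθ₀.norm.congr' hθ1) tendsto_const_nhds
  have hθ₀0 : θ₀ ≠ 0 := norm_ne_zero_iff.1 (by rw [hθ₀1]; exact one_ne_zero)
  have hθb : ∀ i, θ₀ (b₀ i) = 0 := fun i => by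
    refine tendsto_nhds_unique (tendsto_functional_apply hθ₀ (hb₀ i)) ?_
    refine tendsto_const_nhds.congr' ?_
    filter_upwards [hb] with n hn
    simp [hθ, hn.2.1 i]
  have hker := hb₀flat.map_eq_zero_iff hcard hθ₀0 hθb
  have hθa : ∀ i, i ≠ j → θ₀ (a₀ i) = 0 := by
    intro i hij
    have hup : Tendsto (fun n => s n * θ n (a n j)) U (𝓝 0) := by
      simpa using hslim.mul (tendsto_functional_apply hθ₀ (ha₀ j))
    have hval : ∀ n k, θ n (a n k) = r n * (w (s n) k * η n (e k)) := fun n k => by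
      simp [hθ, ha]
      ring
    refine tendsto_nhds_unique (tendsto_functional_apply hθ₀ (ha₀ i)) ?_
    refine tendsto_of_tendsto_of_tendsto_of_le_of_le' tendsto_const_nhds hup ?_ ?_
    · filter_upwards [hη, hrpos] with n h1 h2
      rw [hval]
      exact mul_nonneg h2.le (mul_nonneg (hwpos _ (hspos n) i).le (h1.2.2 i))
    · filter_upwards [hη, hrpos, hjU] with n h1 h2 h4
      rw [hval, hval]
      have h5 : η n (e i) ≤ η n (e j) := h4 ▸ hjmax n i
      have h6 := mul_le_mul_of_nonneg_left h5 (mul_nonneg h2.le (hspos n).le)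
      simp only [hw, if_neg hij, if_true]
      linarith
  have hspan := span_eq_of_facet_mem hC ha₀flat hb₀flat hcard h3 j
    fun k hk => (hker _).1 (hθa k hk)
  have hθa' : ∀ i, θ₀ (a₀ i) = 0 := fun i =>
    (hker _).2 (hspan ▸ Submodule.subset_span (mem_range_self i))
  have hlim' : Tendsto (fun n => ∑ i, w (1 / 2) i • a n i) U (𝓝 (∑ i, w (1 / 2) i • a₀ i)) :=
    tendsto_finsetSum _ fun i _ => (ha₀ i).const_smul _
  have hev := eventually_isNearKer hS hθ₀ hθ₀0 hlim'
    (ha₀flat.sum_mem _ (hwpos _ (by norm_num))) (by simp [hθa'])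
  obtain ⟨n, h1, h2, h4⟩ := (hev.and (hm.and hrpos)).exists
  refine h2.2.2 (IsNearKer.smul_comp_symm (hgC n) h4.ne' ?_)
  have hxg : ∑ i, w (1 / 2) i • a n i = g n (x ((1 / 2) ^ (m n + 1))) := by
    simp only [hx, ha, map_sum, ← map_smul, smul_smul]
    refine Finset.sum_congr rfl fun i _ => ?_
    congr 2
    simp only [hw, hs]
    split_ifs
    · ring
    · ring
  rw [← hxg]
  exact h1

end IsLinFlat

end Cone

theorem mem_coneOver_iff {d : ℕ} {Ω : Set (Euc d)} {p : Euc d × ℝ} :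
    p ∈ coneOver Ω ↔ 0 < p.2 ∧ p.2⁻¹ • p.1 ∈ Ω := by
  constructor
  · rintro ⟨t, ht, x, hx, rfl⟩
    refine ⟨by simpa using ht, ?_⟩
    simpa [smul_smul, ht.ne'] using hx
  · rintro ⟨h1, h2⟩
    refine ⟨p.2, h1, _, h2, ?_⟩
    ext1
    · simp [smul_smul, h1.ne']
    · simp

theorem mk_one_mem_coneOver_iff {d : ℕ} {Ω : Set (Euc d)} {x : Euc d} :
    (x, (1 : ℝ)) ∈ coneOver Ω ↔ x ∈ Ω := by
  simp [mem_coneOver_iff]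

theorem isSalientCone_coneOver {d : ℕ} {Ω : Set (Euc d)} (hne : Ω.Nonempty)
    (hbd : Bornology.IsBounded Ω) (hop : IsOpen Ω) (hconv : Convex ℝ Ω) :
    IsSalientCone (coneOver Ω) where
  isOpen := by
    have hset : coneOver Ω = {p : Euc d × ℝ | 0 < p.2} ∩
        (fun p : Euc d × ℝ => p.2⁻¹ • p.1) ⁻¹' Ω := by
      ext p
      exact mem_coneOver_iff
    rw [hset]
    refine ContinuousOn.isOpen_inter_preimage ?_ (isOpen_lt continuous_const continuous_snd) hop
    have hinv : ContinuousOn (fun p : Euc d × ℝ => p.2⁻¹) {p : Euc d × ℝ | 0 < p.2} :=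
      continuous_snd.continuousOn.inv₀ fun p hp => ne_of_gt hp
    exact hinv.smul continuous_fst.continuousOn
  convex := by
    rintro _ ⟨t, ht, x, hx, rfl⟩ _ ⟨s, hs, y, hy, rfl⟩ a b ha hb hab
    have hpos : 0 < a * t + b * s := by
      rcases ha.lt_or_eq with h | h
      · exact add_pos_of_pos_of_nonneg (mul_pos h ht) (mul_nonneg hb hs.le)
      · subst h
        rw [zero_add] at hab
        subst hab
        simpa using hs
    refine ⟨a * t + b * s, hpos, (a * t / (a * t + b * s)) • x + (b * s / (a * t + b * s)) • y,
      hconv hx hy (by positivity) (by positivity) (by field_simp), ?_⟩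
    ext1
    · simp only [Prod.smul_mk, Prod.mk_add_mk, smul_add, smul_smul]
      rw [mul_div_cancel₀ _ hpos.ne', mul_div_cancel₀ _ hpos.ne']
    · simp
  nonempty := hne.imp' (fun x => (x, (1 : ℝ))) fun x hx => mk_one_mem_coneOver_iff.2 hx
  smul_mem := by
    rintro t ht _ ⟨s, hs, x, hx, rfl⟩
    exact ⟨t * s, mul_pos ht hs, x, hx, by rw [smul_smul]⟩
  salient := by
    obtain ⟨R, hR⟩ := hbd.exists_norm_le
    refine ⟨(|R| + 1) • ContinuousLinearMap.snd ℝ (Euc d) ℝ, ?_⟩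
    rintro _ ⟨t, ht, x, hx, rfl⟩
    rw [norm_smul, Real.norm_eq_abs, abs_of_pos ht]
    have h1 : ‖(x, (1 : ℝ))‖ ≤ |R| + 1 := by
      rw [Prod.norm_def]
      refine max_le ((hR x hx).trans ((le_abs_self R).trans (by linarith))) ?_
      simp
    simpa [mul_comm] using mul_le_mul_of_nonneg_left h1 ht.le

theorem mk_one_mem_closure_coneOver_iff {d : ℕ} {Ω : Set (Euc d)} {x : Euc d} :
    (x, (1 : ℝ)) ∈ closure (coneOver Ω) ↔ x ∈ closure Ω := by
  constructor
  · intro h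
    have hcont : ContinuousAt (fun p : Euc d × ℝ => p.2⁻¹ • p.1) (x, 1) :=
      (continuousAt_snd.inv₀ one_ne_zero).smul continuousAt_fst
    have := closure_mono (t := Ω) (by
      rintro _ ⟨p, hp, rfl⟩
      exact (mem_coneOver_iff.1 hp).2) (hcont.continuousWithinAt.mem_closure_image h)
    simpa using this
  · intro h
    exact map_mem_closure (f := fun y : Euc d => (y, (1 : ℝ))) (by fun_prop) h
      fun y hy => mk_one_mem_coneOver_iff.2 hy

theorem snd_pos_of_mem_closure_coneOver {d : ℕ} {Ω : Set (Euc d)}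
    (hbd : Bornology.IsBounded Ω) {p : Euc d × ℝ} (hp : p ∈ closure (coneOver Ω)) (h0 : p ≠ 0) :
    0 < p.2 := by
  obtain ⟨R, hR⟩ := hbd.exists_norm_le
  have hle : ∀ q ∈ coneOver Ω, ‖q.1‖ ≤ |R| * q.2 := by
    rintro _ ⟨t, ht, x, hx, rfl⟩
    have := mul_le_mul_of_nonneg_left ((hR x hx).trans (le_abs_self R)) ht.le
    simpa [norm_smul, abs_of_pos ht, mul_comm] using this
  have h1 : ‖p.1‖ ≤ |R| * p.2 := closure_minimal (t := {q : Euc d × ℝ | ‖q.1‖ ≤ |R| * q.2}) hle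
    (isClosed_le (by fun_prop) (by fun_prop)) hp
  have h2 : 0 ≤ p.2 := closure_minimal (t := {q : Euc d × ℝ | 0 ≤ q.2})
    (fun q hq => (mem_coneOver_iff.1 hq).1.le) (isClosed_le (by fun_prop) (by fun_prop)) hp
  refine h2.lt_of_ne fun h => h0 ?_
  rw [← h, mul_zero] at h1
  exact Prod.ext (norm_le_zero_iff.1 h1) h.symm

theorem IsDivisibleCone.of_divides {d : ℕ} {Ω : Set (Euc d)} (hne : Ω.Nonempty)
    (hbd : Bornology.IsBounded Ω) (hop : IsOpen Ω) (hconv : Convex ℝ Ω)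
    (hirr : IsIrreducibleDomain Ω) {Γ : Subgroup ((Euc d × ℝ) ≃ₗ[ℝ] (Euc d × ℝ))}
    (hdiv : Divides Ω Γ) : IsDivisibleCone (coneOver Ω) where
  toIsSalientCone := isSalientCone_coneOver hne hbd hop hconv
  cocompact := by
    obtain ⟨hΓ, -, -, K, hKΩ, hK, hcov⟩ := hdiv
    have hS := isSalientCone_coneOver hne hbd hop hconv
    refine ⟨(fun x => (x, (1 : ℝ))) '' K, ?_, hK.image (by fun_prop), ?_⟩
    · rintro _ ⟨x, hx, rfl⟩
      exact mk_one_mem_coneOver_iff.2 (hKΩ hx)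
    · rintro _ ⟨t, ht, y, hy, rfl⟩
      rw [← hcov] at hy
      simp only [mem_iUnion, mem_image] at hy
      obtain ⟨γ, hγ, k, hk, rfl⟩ := hy
      have hmem : γ (k, 1) ∈ coneOver Ω := by
        rw [← hΓ γ hγ]
        exact mem_image_of_mem _ (mk_one_mem_coneOver_iff.2 (hKΩ hk))
      have hτ := (mem_coneOver_iff.1 hmem).1
      set τ := (γ (k, 1)).2 with hτdef
      have hγk : γ (k, 1) = τ • (projAct γ k, (1 : ℝ)) := by
        ext1
        · simp [projAct, ← hτdef, smul_smul, hτ.ne']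
        · simp [hτdef]
      have hr : 0 < t⁻¹ * τ := by positivity
      let g : (Euc d × ℝ) ≃L[ℝ] (Euc d × ℝ) :=
        (γ.symm.trans (LinearEquiv.smulOfNeZero ℝ _ (t⁻¹ * τ) hr.ne')).toContinuousLinearEquiv
      have hg : ∀ p, g p = (t⁻¹ * τ) • γ.symm p := fun p => rfl
      refine ⟨g, ?_, k, hk, ?_⟩
      · ext p
        constructor
        · rintro ⟨q, hq, rfl⟩
          rw [hg]
          refine hS.smul_mem _ hr _ ?_
          rw [← hΓ γ hγ] at hq
          obtain ⟨u, hu, rfl⟩ := hq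
          simpa using hu
        · intro hp
          refine ⟨γ ((t⁻¹ * τ)⁻¹ • p), ?_, ?_⟩
          · rw [← hΓ γ hγ]
            exact mem_image_of_mem _ (hS.smul_mem _ (inv_pos.2 hr) _ hp)
          · rw [hg, LinearEquiv.symm_apply_apply, smul_smul, mul_inv_cancel₀ hr.ne', one_smul]
      · rw [hg, map_smul, smul_smul]
        have : γ.symm (projAct γ k, (1 : ℝ)) = τ⁻¹ • (k, (1 : ℝ)) := by
          rw [LinearEquiv.symm_apply_eq, map_smul, hγk, smul_smul, inv_mul_cancel₀ hτ.ne',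
            one_smul]
        rw [this, smul_smul]
        have : t⁻¹ * τ * t * τ⁻¹ = 1 := by field_simp
        rw [this, one_smul]
  irreducible := by
    intro P hPP hP1 hP2
    by_contra! hcon
    have hS := isSalientCone_coneOver hne hbd hop hconv
    set C := coneOver Ω with hC
    have hproj : LinearMap.IsProj (LinearMap.range P) P :=
      ⟨fun x => ⟨x, rfl⟩, by rintro _ ⟨x, rfl⟩; exact hPP x⟩
    set Q : (Euc d × ℝ) →ₗ[ℝ] (Euc d × ℝ) := LinearMap.id - P with hQ
    have hQa : ∀ x, Q x = x - P x := fun x => rfl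
    have hPQ : ∀ x, P (Q x) = 0 := fun x => by rw [hQa, map_sub, hPP, sub_self]
    have hker : ∀ x, Q x ∈ LinearMap.ker P := fun x => hPQ x
    refine hirr ⟨LinearMap.range P, LinearMap.ker P, P '' C, Q '' C, ?_, ?_, ?_, ?_,
      hproj.isCompl, ?_, ?_, hS.convex.linear_image P, hS.convex.linear_image Q, ?_, ?_, ?_⟩
    · rw [Ne, LinearMap.range_eq_bot]
      exact hcon.1
    · intro h
      refine hcon.2 (LinearMap.ext fun x => ?_)
      have := hker x
      rw [h, Submodule.mem_bot, hQa, sub_eq_zero] at this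
      exact this.symm
    · intro h
      refine hcon.2 (LinearMap.ext fun x => ?_)
      obtain ⟨y, hy⟩ := LinearMap.range_eq_top.1 h x
      rw [← hy, hPP]
      rfl
    · rw [Ne, LinearMap.ker_eq_top]
      exact hcon.1
    · rintro _ ⟨x, -, rfl⟩
      exact ⟨x, rfl⟩
    · rintro _ ⟨x, -, rfl⟩
      exact hker x
    · rintro t ht _ ⟨x, hx, rfl⟩
      exact ⟨t • x, hS.smul_mem t ht x hx, map_smul _ _ _⟩
    · rintro t ht _ ⟨x, hx, rfl⟩
      exact ⟨t • x, hS.smul_mem t ht x hx, map_smul _ _ _⟩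
    · let T : (Euc d × ℝ) × (Euc d × ℝ) →ₗ[ℝ] (Euc d × ℝ) := P.coprod Q
      have hTsurj : Function.Surjective T := fun x => ⟨(x, x), by simp [T, hQa]⟩
      have hopen : IsOpen (T '' (C ×ˢ C)) := by
        have := (LinearMap.toContinuousLinearMap T).isOpenMap hTsurj
        exact this _ (hS.isOpen.prod hS.isOpen)
      have hsub : T '' (C ×ˢ C) ⊆ C := by
        suffices h : T '' (C ×ˢ C) ⊆ closure C by
          have := interior_maximal h hopen
          rwa [hS.interior_closure] at this
        rintro _ ⟨⟨x, y⟩, ⟨hx, hy⟩, rfl⟩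
        exact hS.add_mem_closure (hP1 x (subset_closure hx)) (hP2 y (subset_closure hy))
      ext p
      constructor
      · intro hp
        exact ⟨P p, mem_image_of_mem _ hp, Q p, mem_image_of_mem _ hp, by simp [hQa]⟩
      · rintro ⟨_, ⟨x, hx, rfl⟩, _, ⟨y, hy, rfl⟩, rfl⟩
        exact hsub ⟨(x, y), ⟨hx, hy⟩, rfl⟩

theorem LinearIndependent.exists_continuousLinearMap_coeff {E ι : Type*} [NormedAddCommGroup E]
    [NormedSpace ℝ E] [FiniteDimensional ℝ E] [Fintype ι] {e : ι → E}
    (he : LinearIndependent ℝ e) :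
    ∃ φ : E →L[ℝ] (ι → ℝ), ∀ c : ι → ℝ, φ (∑ i, c i • e i) = c := by
  obtain ⟨g, hg⟩ := (Fintype.linearCombination ℝ e).exists_leftInverse_of_injective
    (LinearMap.ker_eq_bot.2 (linearIndependent_iff_injective_fintypeLinearCombination.1 he))
  exact ⟨LinearMap.toContinuousLinearMap g, fun c => LinearMap.congr_fun hg c⟩

theorem sum_smul_mk_one {V ι : Type*} [AddCommGroup V] [Module ℝ V] [Fintype ι] (v : ι → V)
    (w : ι → ℝ) :
    ∑ i, w i • (v i, (1 : ℝ)) = (∑ i, w i • v i, ∑ i, w i) := by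
  ext1
  · simp [Prod.fst_sum]
  · simp [Prod.snd_sum]

theorem affineIndependent_iff_linearIndependent_mk_one {V ι : Type*} [AddCommGroup V] [Module ℝ V]
    {v : ι → V} :
    AffineIndependent ℝ v ↔ LinearIndependent ℝ fun i => (v i, (1 : ℝ)) := by
  rw [affineIndependent_iff, linearIndependent_iff']
  refine forall₂_congr fun s w => ?_
  rw [Prod.ext_iff]
  simp only [Prod.fst_sum, Prod.snd_sum, Prod.smul_fst, Prod.smul_snd, smul_eq_mul, mul_one,
    Prod.fst_zero, Prod.snd_zero]
  tauto

theorem mem_convexHull_range_iff {V ι : Type*} [AddCommGroup V] [Module ℝ V] [Fintype ι]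
    {v : ι → V} {x : V} :
    x ∈ convexHull ℝ (range v) ↔ ∃ w : ι → ℝ, (∀ i, 0 ≤ w i) ∧ ∑ i, w i = 1 ∧
      x = ∑ i, w i • v i := by
  classical
  constructor
  · refine fun h => convexHull_min (t := {x | ∃ w : ι → ℝ, (∀ i, 0 ≤ w i) ∧ ∑ i, w i = 1 ∧
      x = ∑ i, w i • v i}) ?_ ?_ h
    · rintro _ ⟨i, rfl⟩
      refine ⟨Pi.single i 1, fun j => ?_, by simp, by simp [Pi.single_apply]⟩
      by_cases hj : j = i
      · subst hj; simp
      · simp [hj]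
    · rintro _ ⟨w, hw, hw1, rfl⟩ _ ⟨w', hw', hw1', rfl⟩ a b ha hb hab
      refine ⟨fun i => a * w i + b * w' i, fun i => ?_, ?_, ?_⟩
      · exact add_nonneg (mul_nonneg ha (hw i)) (mul_nonneg hb (hw' i))
      · rw [Finset.sum_add_distrib, ← Finset.mul_sum, ← Finset.mul_sum, hw1, hw1']
        simpa using hab
      · simp [add_smul, mul_smul, Finset.sum_add_distrib, Finset.smul_sum]
  · rintro ⟨w, hw, hw1, rfl⟩
    exact mem_convexHull_of_exists_fintype w v hw hw1 (fun i => mem_range_self i) rfl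

theorem AffineIndependent.mem_intrinsicInterior_convexHull_iff {V ι : Type*}
    [NormedAddCommGroup V] [NormedSpace ℝ V] [FiniteDimensional ℝ V] [Fintype ι] {v : ι → V}
    (hv : AffineIndependent ℝ v) {x : V} :
    x ∈ intrinsicInterior ℝ (convexHull ℝ (range v)) ↔
      ∃ w : ι → ℝ, (∀ i, 0 < w i) ∧ ∑ i, w i = 1 ∧ x = ∑ i, w i • v i := by
  classical
  obtain ⟨φ, hφ⟩ :=
    (affineIndependent_iff_linearIndependent_mk_one.1 hv).exists_continuousLinearMap_coeff
  have hφ' : ∀ w : ι → ℝ, ∑ i, w i = 1 → φ (∑ i, w i • v i, (1 : ℝ)) = w := fun w hw => by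
    rw [← hw, ← sum_smul_mk_one, hφ]
  rw [mem_intrinsicInterior]
  constructor
  · rintro ⟨y, hy, rfl⟩
    have hyc : (y : V) ∈ convexHull ℝ (range v) := mem_preimage.1 (interior_subset hy)
    obtain ⟨w, hw, hw1, hyw⟩ := mem_convexHull_range_iff.1 hyc
    refine ⟨w, fun i => (hw i).lt_of_ne fun h0 => ?_, hw1, hyw⟩
    have hvi : v i ∈ affineSpan ℝ (convexHull ℝ (range v)) :=
      subset_affineSpan ℝ _ (subset_convexHull ℝ _ (mem_range_self i))
    let f : ℝ → affineSpan ℝ (convexHull ℝ (range v)) := fun t =>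
      ⟨AffineMap.lineMap (y : V) (v i) t, AffineMap.lineMap_mem t y.2 hvi⟩
    have hf : Continuous f := (AffineMap.lineMap_continuous).subtype_mk _
    have hf0 : f 0 = y := Subtype.ext (by simp [f])
    have hev : ∀ᶠ t in 𝓝[<] (0 : ℝ), (f t : V) ∈ convexHull ℝ (range v) := by
      have : ∀ᶠ t in 𝓝 (0 : ℝ), f t ∈ interior
          ((↑) ⁻¹' convexHull ℝ (range v) : Set (affineSpan ℝ (convexHull ℝ (range v)))) :=
        hf.continuousAt.eventually (by rw [hf0]; exact isOpen_interior.mem_nhds hy)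
      exact (this.filter_mono nhdsWithin_le_nhds).mono fun t ht =>
        mem_preimage.1 (interior_subset ht)
    obtain ⟨t, ht, ht0⟩ := (hev.and self_mem_nhdsWithin).exists
    obtain ⟨w', hw', hw1', htw⟩ := mem_convexHull_range_iff.1 ht
    have h1 := hφ' w' hw1'
    have h2 : ((f t : V), (1 : ℝ)) = (1 - t) • ((y : V), (1 : ℝ)) + t • (v i, (1 : ℝ)) := by
      ext1
      · simp only [f, AffineMap.lineMap_apply_module, Prod.fst_add, Prod.smul_fst]
      · simp
    have h3 : φ (v i, (1 : ℝ)) i = 1 := by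
      have := congrFun (hφ (Pi.single i 1)) i
      simpa [Pi.single_apply] using this
    have h4 : φ ((y : V), (1 : ℝ)) i = 0 := by rw [hyw, hφ' w hw1, h0]
    rw [← htw, h2, map_add, map_smul, map_smul] at h1
    have h5 := congrFun h1 i
    simp only [Pi.add_apply, Pi.smul_apply, h3, h4, smul_eq_mul] at h5
    have := hw' i
    have ht0 : t < 0 := ht0
    linarith
  · rintro ⟨w, hw, hw1, rfl⟩
    have hmem : ∑ i, w i • v i ∈ convexHull ℝ (range v) :=
      mem_convexHull_range_iff.2 ⟨w, fun i => (hw i).le, hw1, rfl⟩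
    refine ⟨⟨_, subset_affineSpan ℝ _ hmem⟩, ?_, rfl⟩
    have hopen : IsOpen {y : affineSpan ℝ (convexHull ℝ (range v)) |
        ∀ i, 0 < φ ((y : V), (1 : ℝ)) i} := by
      simp only [ofPred_forall]
      exact isOpen_iInter_of_finite fun i => isOpen_lt continuous_const (by fun_prop)
    refine interior_maximal ?_ hopen (fun i => by simp only [hφ' w hw1]; exact hw i)
    rintro ⟨y, hy⟩ hypos
    change ∀ i, 0 < φ (y, (1 : ℝ)) i at hypos
    change y ∈ convexHull ℝ (range v)
    rw [affineSpan_convexHull] at hy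
    obtain ⟨a, ha, rfl⟩ := eq_affineCombination_of_mem_affineSpan_of_fintype hy
    rw [Finset.affineCombination_eq_linear_combination _ _ _ ha] at hypos ⊢
    refine mem_convexHull_range_iff.2 ⟨a, fun i => ?_, ha, rfl⟩
    have := hypos i
    rw [hφ' a ha] at this
    exact this.le

/-- The affine slice of `C` by the span of `e`. -/
def flatSection {d : ℕ} (C : Set (Euc d × ℝ)) (e : Fin d → Euc d × ℝ) : Set (Euc d) :=
  {x | (x, (1 : ℝ)) ∈ C ∧ (x, (1 : ℝ)) ∈ Submodule.span ℝ (range e)}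

theorem isFlatWith_iff {d : ℕ} {Ω : Set (Euc d)} (hd : 2 ≤ d) {v : Fin d → Euc d} :
    IsFlatWith Ω v ↔ IsLinFlat (coneOver Ω) fun i => (v i, (1 : ℝ)) := by
  have : Nontrivial (Fin d) := Fin.nontrivial_iff_two_le.2 hd
  constructor
  · rintro ⟨hv, -, hI, hB⟩
    have hsum : ∀ c : Fin d → ℝ, 0 < ∑ i, c i → ∑ i, (∑ k, c k)⁻¹ * c i = 1 := fun c hc => by
      rw [← Finset.mul_sum, inv_mul_cancel₀ hc.ne']
    refine ⟨affineIndependent_iff_linearIndependent_mk_one.1 hv, fun c hc => ?_, ?_⟩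
    · have hs : 0 < ∑ i, c i := Finset.sum_pos (fun i _ => hc i) Finset.univ_nonempty
      rw [sum_smul_mk_one, mem_coneOver_iff]
      refine ⟨hs, hI (hv.mem_intrinsicInterior_convexHull_iff.2
        ⟨fun i => (∑ k, c k)⁻¹ * c i, fun i => mul_pos (inv_pos.2 hs) (hc i), hsum c hs, ?_⟩)⟩
      simp [Finset.smul_sum, mul_smul]
    · rintro c hc ⟨i, hi⟩ hmem
      rw [sum_smul_mk_one, mem_coneOver_iff] at hmem
      obtain ⟨hs, hmem⟩ := hmem
      replace hs : 0 < ∑ i, c i := hs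
      have hx : (∑ k, c k)⁻¹ • ∑ k, c k • v k = ∑ k, ((∑ k, c k)⁻¹ * c k) • v k := by
        simp [Finset.smul_sum, mul_smul]
      replace hmem : (∑ k, c k)⁻¹ • ∑ k, c k • v k ∈ Ω := hmem
      rw [hx] at hmem
      refine (hB ⟨mem_convexHull_range_iff.2 ⟨_, fun i => mul_nonneg (inv_pos.2 hs).le (hc i),
        hsum c hs, rfl⟩, fun hint => ?_⟩).2 hmem
      obtain ⟨w, hw, hw1, hxw⟩ := hv.mem_intrinsicInterior_convexHull_iff.1 hint
      have h1 : ∑ k, ((∑ k, c k)⁻¹ * c k) • (v k, (1 : ℝ)) = ∑ k, w k • (v k, (1 : ℝ)) := by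
        rw [sum_smul_mk_one, sum_smul_mk_one, hxw, hsum c hs, hw1]
      have h2 := linearIndependent_iff_injective_fintypeLinearCombination.1
        (affineIndependent_iff_linearIndependent_mk_one.1 hv) h1
      have h3 := congrFun h2 i
      simp only [hi, mul_zero] at h3
      exact (hw i).ne h3
  · intro h
    have hv := affineIndependent_iff_linearIndependent_mk_one.2 h.linearIndependent
    have hnot : ∀ w : Fin d → ℝ, (∀ i, 0 ≤ w i) → ∑ i, w i = 1 → (∃ i, w i = 0) →
        ∑ i, w i • v i ∈ closure Ω \ Ω := fun w hw hw1 hw0 => by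
      refine ⟨?_, fun hmem => ?_⟩
      · rw [← mk_one_mem_closure_coneOver_iff, ← hw1, ← sum_smul_mk_one]
        exact h.sum_mem_closure hw
      · rw [← mk_one_mem_coneOver_iff, ← hw1, ← sum_smul_mk_one] at hmem
        exact h.sum_notMem w hw hw0 hmem
    refine ⟨hv, fun j => ?_, fun x hx => ?_, ?_⟩
    · obtain ⟨k, hk⟩ := exists_ne j
      have := hnot (Pi.single j 1) (fun i => by
        by_cases hi : i = j
        · subst hi; simp
        · simp [hi]) (by simp) ⟨k, by simp [hk]⟩
      simpa [Pi.single_apply] using this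
    · obtain ⟨w, hw, hw1, rfl⟩ := hv.mem_intrinsicInterior_convexHull_iff.1 hx
      rw [← mk_one_mem_coneOver_iff, ← hw1, ← sum_smul_mk_one]
      exact h.sum_mem w hw
    · rintro x ⟨hx, hxI⟩
      obtain ⟨w, hw, hw1, rfl⟩ := mem_convexHull_range_iff.1 hx
      refine hnot w hw hw1 ?_
      by_contra! hw0
      exact hxI (hv.mem_intrinsicInterior_convexHull_iff.2
        ⟨w, fun i => (hw i).lt_of_ne (hw0 i).symm, hw1, rfl⟩)

theorem intrinsicInterior_eq_flatSection {d : ℕ} {Ω : Set (Euc d)}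
    (hC : IsSalientCone (coneOver Ω)) {v : Fin d → Euc d}
    (h : IsLinFlat (coneOver Ω) fun i => (v i, (1 : ℝ))) :
    intrinsicInterior ℝ (convexHull ℝ (range v)) =
      flatSection (coneOver Ω) fun i => (v i, (1 : ℝ)) := by
  have hv := affineIndependent_iff_linearIndependent_mk_one.2 h.linearIndependent
  ext x
  rw [hv.mem_intrinsicInterior_convexHull_iff]
  constructor
  · rintro ⟨w, hw, hw1, rfl⟩
    have h1 : (∑ i, w i • v i, (1 : ℝ)) = ∑ i, w i • (v i, (1 : ℝ)) := by
      rw [sum_smul_mk_one, hw1]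
    constructor
    · rw [h1]
      exact h.sum_mem w hw
    · rw [h1]
      exact IsLinFlat.sum_mem_span w
  · rintro ⟨hx, hxs⟩
    obtain ⟨c, hc⟩ := IsLinFlat.exists_coeff hxs
    have hpos := fun i => h.coeff_pos hC (c := c) (hc ▸ hx) i
    rw [sum_smul_mk_one, Prod.ext_iff] at hc
    exact ⟨c, hpos, hc.2.symm, hc.1⟩

theorem isFlat_iff {d : ℕ} {Ω : Set (Euc d)} (hd : 2 ≤ d) (hbd : Bornology.IsBounded Ω)
    (hC : IsSalientCone (coneOver Ω)) {F : Set (Euc d)} :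
    IsFlat Ω F ↔ ∃ e, IsLinFlat (coneOver Ω) e ∧ F = flatSection (coneOver Ω) e := by
  constructor
  · rintro ⟨v, hv, rfl⟩
    have h := (isFlatWith_iff hd).1 hv
    exact ⟨_, h, intrinsicInterior_eq_flatSection hC h⟩
  · rintro ⟨e, he, rfl⟩
    have hpos : ∀ i, 0 < (e i).2 := fun i =>
      snd_pos_of_mem_closure_coneOver hbd (he.mem_closure i) (he.linearIndependent.ne_zero i)
    have hsmul : (fun i => ((e i).2⁻¹ • (e i).1, (1 : ℝ))) = fun i => (e i).2⁻¹ • e i := by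
      ext1 i
      ext1
      · simp
      · simp [(hpos i).ne']
    have h : IsLinFlat (coneOver Ω) fun i => ((e i).2⁻¹ • (e i).1, (1 : ℝ)) := by
      rw [hsmul]
      exact he.smul fun i => inv_pos.2 (hpos i)
    refine ⟨_, (isFlatWith_iff hd).2 h, ?_⟩
    rw [intrinsicInterior_eq_flatSection hC h, hsmul]
    have := (he.smul fun i => inv_pos.2 (hpos i)).span_eq_of_le he fun i =>
      Submodule.smul_mem _ _ (Submodule.subset_span (mem_range_self i))
    simp only [flatSection, this]

theorem flatSection_subset {d : ℕ} {Ω : Set (Euc d)} {e : Fin d → Euc d × ℝ} :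
    flatSection (coneOver Ω) e ⊆ Ω := fun _ hx => mk_one_mem_coneOver_iff.1 hx.1

theorem convex_flatSection {d : ℕ} {C : Set (Euc d × ℝ)} (hC : IsSalientCone C)
    {e : Fin d → Euc d × ℝ} : Convex ℝ (flatSection C e) := by
  intro x hx y hy a b ha hb hab
  have h : (a • x + b • y, (1 : ℝ)) = a • (x, (1 : ℝ)) + b • (y, (1 : ℝ)) := by
    simp [hab]
  constructor
  · rw [h]
    exact hC.convex hx.1 hy.1 ha hb hab
  · rw [h]
    exact (Submodule.span ℝ (range e)).convex hx.2 hy.2 ha hb hab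

theorem flatSection_congr {d : ℕ} {C : Set (Euc d × ℝ)} {e f : Fin d → Euc d × ℝ}
    (h : Submodule.span ℝ (range e) = Submodule.span ℝ (range f)) :
    flatSection C e = flatSection C f := by
  simp only [flatSection, h]

theorem IsLinFlat.exists_sum_eq {d : ℕ} {Ω : Set (Euc d)} (hC : IsSalientCone (coneOver Ω))
    {e : Fin d → Euc d × ℝ} (he : IsLinFlat (coneOver Ω) e) {x : Euc d}
    (hx : x ∈ flatSection (coneOver Ω) e) :
    ∃ f, IsLinFlat (coneOver Ω) f ∧ ∑ i, f i = (x, (1 : ℝ)) ∧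
      flatSection (coneOver Ω) e = flatSection (coneOver Ω) f := by
  obtain ⟨c, hc⟩ := IsLinFlat.exists_coeff hx.2
  have hpos : ∀ i, 0 < c i := he.coeff_pos hC (hc ▸ hx.1)
  refine ⟨_, he.smul hpos, hc.symm, flatSection_congr ?_⟩
  exact ((he.smul hpos).span_eq_of_le he fun i =>
    Submodule.smul_mem _ _ (Submodule.subset_span (mem_range_self i))).symm

theorem finite_setOf_isFlat_inter_nonempty {d : ℕ} {Ω : Set (Euc d)} (hd : 3 ≤ d)
    (hbd : Bornology.IsBounded Ω) (hC : IsDivisibleCone (coneOver Ω)) {K : Set (Euc d)}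
    (hKΩ : K ⊆ Ω) (hK : IsCompact K) : {F | IsFlat Ω F ∧ (F ∩ K).Nonempty}.Finite := by
  have hS := hC.toIsSalientCone
  by_contra hinf
  have hφ := (Set.Infinite.natEmbedding _ hinf).injective
  set φ := Set.Infinite.natEmbedding _ hinf
  have hex : ∀ n, ∃ f x, IsLinFlat (coneOver Ω) f ∧ x ∈ K ∧ ∑ i, f i = (x, (1 : ℝ)) ∧
      (φ n : Set (Euc d)) = flatSection (coneOver Ω) f := fun n => by
    obtain ⟨hF, x, hxF, hxK⟩ := (φ n).2
    obtain ⟨e, he, hFe⟩ := (isFlat_iff (by omega) hbd hS).1 hF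
    rw [hFe] at hxF
    obtain ⟨f, hf, hsum, hfe⟩ := he.exists_sum_eq hS hxF
    exact ⟨f, x, hf, hxK, hsum, hFe.trans hfe⟩
  choose f x hf hx hsum hflat using hex
  have hK1 : IsCompact ((fun x : Euc d => (x, (1 : ℝ))) '' K) := hK.image (by fun_prop)
  have hmem : ∀ n, ∑ i, f n i ∈ (fun x : Euc d => (x, (1 : ℝ))) '' K := fun n =>
    ⟨x n, hx n, (hsum n).symm⟩
  obtain ⟨R, hR⟩ := hK1.isBounded.exists_norm_le
  obtain ⟨e, he⟩ := IsLinFlat.exists_tendsto_of_norm_sum_le hS (U := hyperfilter ℕ)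
    (Eventually.of_forall hf) (Eventually.of_forall fun n => hR _ (hmem n))
  have hesum : ∑ i, e i ∈ coneOver Ω := by
    obtain ⟨y, hy, hye⟩ := hK1.isClosed.mem_of_tendsto (tendsto_finsetSum _ fun i _ => he i)
      (Eventually.of_forall hmem)
    rw [← hye]
    exact mk_one_mem_coneOver_iff.2 (hKΩ hy)
  have heflat := IsLinFlat.of_tendsto hS (Eventually.of_forall hf) he hesum
  have hev := heflat.eventually_span_eq hC (by simp) (by simpa using hd) hf he
  refine notMem_hyperfilter_of_finite (Set.Subsingleton.finite ?_) hev
  intro m hm n hn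
  refine hφ (Subtype.ext ?_)
  rw [hflat m, hflat n]
  exact flatSection_congr (hm.trans hn.symm)

theorem apply_mk_one_eq_smul_projAct {d : ℕ} {Ω : Set (Euc d)}
    {g : (Euc d × ℝ) ≃ₗ[ℝ] (Euc d × ℝ)} (hg : g '' coneOver Ω = coneOver Ω) {x : Euc d}
    (hx : x ∈ Ω) :
    0 < (g (x, 1)).2 ∧ g (x, 1) = (g (x, 1)).2 • (projAct g x, (1 : ℝ)) := by
  have hpos : 0 < (g (x, 1)).2 := by
    have : g (x, 1) ∈ coneOver Ω := hg ▸ mem_image_of_mem g (mk_one_mem_coneOver_iff.2 hx)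
    exact (mem_coneOver_iff.1 this).1
  refine ⟨hpos, Prod.ext ?_ ?_⟩
  · simp [projAct, smul_smul, hpos.ne']
  · simp

theorem projAct_symm_projAct {d : ℕ} {Ω : Set (Euc d)}
    {g : (Euc d × ℝ) ≃ₗ[ℝ] (Euc d × ℝ)} (hg : g '' coneOver Ω = coneOver Ω) {x : Euc d}
    (hx : x ∈ Ω) : projAct g.symm (projAct g x) = x := by
  obtain ⟨hpos, h⟩ := apply_mk_one_eq_smul_projAct hg hx
  have h1 : g.symm (projAct g x, (1 : ℝ)) = (g (x, 1)).2⁻¹ • (x, (1 : ℝ)) := by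
    rw [LinearEquiv.symm_apply_eq, map_smul]
    nth_rw 2 [h]
    rw [smul_smul, inv_mul_cancel₀ hpos.ne', one_smul]
  have h2 := hpos.ne'
  simp [projAct.eq_1 g.symm, h1, smul_smul, h2]

theorem projAct_mem {d : ℕ} {Ω : Set (Euc d)}
    {g : (Euc d × ℝ) ≃ₗ[ℝ] (Euc d × ℝ)} (hg : g '' coneOver Ω = coneOver Ω) {x : Euc d}
    (hx : x ∈ Ω) : projAct g x ∈ Ω :=
  (mem_coneOver_iff.1 (hg ▸ mem_image_of_mem g (mk_one_mem_coneOver_iff.2 hx))).2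

theorem symm_image_coneOver {d : ℕ} {Ω : Set (Euc d)}
    {g : (Euc d × ℝ) ≃ₗ[ℝ] (Euc d × ℝ)} (hg : g '' coneOver Ω = coneOver Ω) :
    g.symm '' coneOver Ω = coneOver Ω := by
  nth_rw 1 [← hg]
  rw [image_image]
  simp

theorem projAct_mem_flatSection {d : ℕ} {Ω : Set (Euc d)}
    {g : (Euc d × ℝ) ≃ₗ[ℝ] (Euc d × ℝ)} (hg : g '' coneOver Ω = coneOver Ω)
    {e : Fin d → Euc d × ℝ} {x : Euc d} (hx : x ∈ flatSection (coneOver Ω) e) :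
    projAct g x ∈ flatSection (coneOver Ω) fun i => g (e i) := by
  have hxΩ := flatSection_subset hx
  obtain ⟨hpos, h⟩ := apply_mk_one_eq_smul_projAct hg hxΩ
  refine ⟨mk_one_mem_coneOver_iff.2 (projAct_mem hg hxΩ), ?_⟩
  have h1 : (projAct g x, (1 : ℝ)) = (g (x, 1)).2⁻¹ • g (x, 1) := by
    nth_rw 2 [h]
    rw [smul_smul, inv_mul_cancel₀ hpos.ne', one_smul]
  rw [h1]
  refine Submodule.smul_mem _ _ ?_
  obtain ⟨c, hc⟩ := IsLinFlat.exists_coeff hx.2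
  rw [hc, map_sum]
  simp only [map_smul]
  exact IsLinFlat.sum_mem_span c

theorem image_projAct_flatSection {d : ℕ} {Ω : Set (Euc d)}
    {g : (Euc d × ℝ) ≃ₗ[ℝ] (Euc d × ℝ)} (hg : g '' coneOver Ω = coneOver Ω)
    {e : Fin d → Euc d × ℝ} :
    projAct g '' flatSection (coneOver Ω) e = flatSection (coneOver Ω) fun i => g (e i) := by
  ext y
  constructor
  · rintro ⟨x, hx, rfl⟩
    exact projAct_mem_flatSection hg hx
  · intro hy
    have hg' := symm_image_coneOver hg
    refine ⟨projAct g.symm y, ?_, projAct_symm_projAct hg' (flatSection_subset hy)⟩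
    simpa using projAct_mem_flatSection hg' hy

theorem IsFlat.image_projAct {d : ℕ} {Ω : Set (Euc d)} (hd : 2 ≤ d)
    (hbd : Bornology.IsBounded Ω) (hC : IsSalientCone (coneOver Ω))
    {g : (Euc d × ℝ) ≃ₗ[ℝ] (Euc d × ℝ)} (hg : g '' coneOver Ω = coneOver Ω) {F : Set (Euc d)}
    (hF : IsFlat Ω F) : IsFlat Ω (projAct g '' F) := by
  obtain ⟨e, he, rfl⟩ := (isFlat_iff hd hbd hC).1 hF
  rw [image_projAct_flatSection hg]
  exact (isFlat_iff hd hbd hC).2 ⟨_, he.map (g := g.toContinuousLinearEquiv) hg, rfl⟩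

theorem IsFlat.nonempty {d : ℕ} {Ω F : Set (Euc d)} (hd : 2 ≤ d)
    (hF : IsFlat Ω F) : F.Nonempty := by
  have : Nonempty (Fin d) := ⟨⟨0, by omega⟩⟩
  obtain ⟨v, -, rfl⟩ := hF
  exact ((range_nonempty v).convexHull).intrinsicInterior (convex_convexHull ℝ _)

theorem IsFlat.subset {d : ℕ} {Ω F : Set (Euc d)} (hF : IsFlat Ω F) : F ⊆ Ω := by
  obtain ⟨v, hv, rfl⟩ := hF
  exact hv.2.2.1

theorem exists_finite_orbit_representatives {d : ℕ} {Ω : Set (Euc d)} (hd : 3 ≤ d)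
    (hbd : Bornology.IsBounded Ω) (hC : IsDivisibleCone (coneOver Ω))
    {Γ : Subgroup ((Euc d × ℝ) ≃ₗ[ℝ] (Euc d × ℝ))} (hdiv : Divides Ω Γ) :
    ∃ (k : ℕ) (Fs : Fin k → Set (Euc d)), (∀ j, IsFlat Ω (Fs j)) ∧
      ∀ F : Set (Euc d), IsFlat Ω F → ∃ γ ∈ Γ, ∃ j : Fin k, F = projAct γ '' Fs j := by
  obtain ⟨hΓ, -, -, K, hKΩ, hK, hcov⟩ := hdiv
  have hfin := finite_setOf_isFlat_inter_nonempty hd hbd hC hKΩ hK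
  have := hfin.to_subtype
  obtain ⟨k, ⟨σ⟩⟩ := Finite.exists_equiv_fin {F | IsFlat Ω F ∧ (F ∩ K).Nonempty}
  refine ⟨k, fun j => σ.symm j, fun j => (σ.symm j).2.1, fun F hF => ?_⟩
  obtain ⟨x, hx⟩ := hF.nonempty (by omega)
  have hxΩ := hF.subset hx
  rw [← hcov] at hxΩ
  simp only [mem_iUnion] at hxΩ
  obtain ⟨γ, hγ, y, hy, rfl⟩ := hxΩ
  have hg := symm_image_coneOver (hΓ γ hγ)
  have hF' := hF.image_projAct (by omega) hbd hC.toIsSalientCone hg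
  refine ⟨γ, hγ, σ ⟨projAct γ.symm '' F, hF', y, ⟨_, hx, ?_⟩, hy⟩, ?_⟩
  · exact projAct_symm_projAct (hΓ γ hγ) (hKΩ hy)
  · simp only [Equiv.symm_apply_apply, image_image]
    have : EqOn (fun x => projAct γ (projAct γ.symm x)) id F := fun z hz =>
      projAct_symm_projAct hg (hF.subset hz)
    rw [this.image_eq, image_id]

theorem IsFlat.eventually_notMem {d : ℕ} {Ω : Set (Euc d)} (hd : 3 ≤ d)
    (hbd : Bornology.IsBounded Ω) (hop : IsOpen Ω) (hC : IsDivisibleCone (coneOver Ω))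
    {F : Set (Euc d)} (hF : IsFlat Ω F) {x : Euc d} (hx : x ∈ F) :
    ∀ᶠ y in 𝓝 x, y ∈ Ω ∧ ∀ F', IsFlat Ω F' → y ∈ F' → F' = F := by
  have hS := hC.toIsSalientCone
  obtain ⟨r, hr, hrΩ⟩ := nhds_basis_closedBall.mem_iff.1 (hop.mem_nhds (hF.subset hx))
  have hfin := finite_setOf_isFlat_inter_nonempty hd hbd hC hrΩ (isCompact_closedBall x r)
  have hev : ∀ᶠ y in 𝓝 x, ∀ F' ∈ {F | IsFlat Ω F ∧ (F ∩ closedBall x r).Nonempty},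
      y ∈ F' → F' = F := by
    rw [eventually_all_finite hfin]
    rintro F' ⟨hF', -⟩
    by_cases hFF : F' = F
    · exact Eventually.of_forall fun y _ => hFF
    obtain ⟨e, he, rfl⟩ := (isFlat_iff (by omega) hbd hS).1 hF
    obtain ⟨f, hf, rfl⟩ := (isFlat_iff (by omega) hbd hS).1 hF'
    obtain ⟨θ, -, hθ⟩ := hf.exists_functional (by simp)
    have hne : θ (x, (1 : ℝ)) ≠ 0 := fun h0 => hFF (flatSection_congr
      (hf.span_eq_of_mem hC he (by simp) (by simpa using hd) hx.1 ((hθ _).1 h0) hx.2))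
    have hcont : Continuous fun y : Euc d => θ (y, (1 : ℝ)) := by fun_prop
    filter_upwards [hcont.continuousAt.eventually_ne hne] with y hy hyF
    exact absurd ((hθ _).2 hyF.2) hy
  filter_upwards [hev, closedBall_mem_nhds x hr] with y hy hyr
  exact ⟨hrΩ hyr, fun F' hF' hyF => hy F' ⟨hF', y, hyF, hyr⟩ hyF⟩

theorem IsFlat.isBoundaryFlat {d : ℕ} {Ω : Set (Euc d)} (hd : 3 ≤ d)
    (hbd : Bornology.IsBounded Ω) (hop : IsOpen Ω) (hC : IsDivisibleCone (coneOver Ω))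
    {F : Set (Euc d)} (hF : IsFlat Ω F) : IsBoundaryFlat Ω F := by
  have hS := hC.toIsSalientCone
  refine ⟨hF, ?_⟩
  have hloc := fun x (hx : x ∈ F) => hF.eventually_notMem hd hbd hop hC hx
  obtain ⟨x₀, hx₀⟩ := hF.nonempty (by omega)
  obtain ⟨e, he, hFe⟩ := (isFlat_iff (by omega) hbd hS).1 hF
  have hFconv : Convex ℝ F := hFe ▸ convex_flatSection hS
  obtain ⟨η, hη1, hη⟩ := he.exists_functional (by simp)
  have hηF : ∀ x ∈ F, η (x, (1 : ℝ)) = 0 := fun x hx => by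
    rw [hFe] at hx
    exact (hη _).2 hx.2
  obtain ⟨u, hu⟩ : ∃ u : Euc d, 0 < η (u, (0 : ℝ)) := by
    by_contra! hcon
    have h0 : ∀ u : Euc d, η (u, (0 : ℝ)) = 0 := fun u => by
      refine le_antisymm (hcon u) ?_
      have h1 := hcon (-u)
      have h2 : ((-u, (0 : ℝ)) : Euc d × ℝ) = -(u, (0 : ℝ)) := by simp
      rw [h2, map_neg] at h1
      linarith
    have : η = 0 := by
      ext p
      · exact h0 p
      · have h3 : ((0 : Euc d), (1 : ℝ)) = (x₀, (1 : ℝ)) - (x₀, (0 : ℝ)) := by simp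
        change η ((0 : Euc d), (1 : ℝ)) = 0
        rw [h3, map_sub, hηF x₀ hx₀, h0, sub_zero]
    simp [this] at hη1
  have hηu : ∀ x ∈ F, ∀ t : ℝ, η (x + t • u, (1 : ℝ)) = t * η (u, (0 : ℝ)) := fun x hx t => by
    have h1 : (x + t • u, (1 : ℝ)) = (x, (1 : ℝ)) + t • (u, (0 : ℝ)) := by simp
    rw [h1, map_add, map_smul, hηF x hx, zero_add, smul_eq_mul]
  set X := Ω \ flatsUnion Ω with hX
  have hball : ∀ x ∈ F, ∃ r > 0, ball x r ∩ {y | 0 < η (y, (1 : ℝ))} ⊆ X := fun x hx => by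
    obtain ⟨r, hr, h⟩ := Metric.eventually_nhds_iff_ball.1 (hloc x hx)
    refine ⟨r, hr, ?_⟩
    rintro y ⟨hyr, hy⟩
    refine ⟨(h y hyr).1, ?_⟩
    rintro ⟨F', hF', hyF⟩
    rw [(h y hyr).2 F' hF' hyF] at hyF
    exact hy.ne' (hηF y hyF)
  choose! r hr hrX using hball
  have hconv : ∀ x, Convex ℝ (ball x (r x) ∩ {y | 0 < η (y, (1 : ℝ))}) := fun x => by
    refine (convex_ball x (r x)).inter ?_
    have : {y : Euc d | 0 < η (y, (1 : ℝ))} =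
        {y | -η ((0 : Euc d), (1 : ℝ)) < η (y, (0 : ℝ))} := by
      ext y
      have h1 : (y, (1 : ℝ)) = (y, (0 : ℝ)) + ((0 : Euc d), (1 : ℝ)) := by simp
      simp only [mem_ofPred_eq, h1, map_add]
      constructor <;> intro h <;> linarith
    rw [this]
    exact convex_halfSpace_gt (f := fun y : Euc d => η (y, (0 : ℝ)))
      (η ∘L ContinuousLinearMap.inl ℝ (Euc d) ℝ).toLinearMap.isLinear _
  have htu : ∀ x, Tendsto (fun t : ℝ => x + t • u) (𝓝[>] 0) (𝓝 x) := fun x => by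
    have : Continuous fun t : ℝ => x + t • u := by fun_prop
    simpa using (this.tendsto 0).mono_left nhdsWithin_le_nhds
  have hev : ∀ x ∈ F, ∀ y ∈ F, y ∈ ball x (r x) →
      ∀ᶠ t in 𝓝[>] (0 : ℝ), y + t • u ∈ ball x (r x) ∩ {y | 0 < η (y, (1 : ℝ))} := by
    intro x hx y hy hyx
    filter_upwards [(htu y).eventually (isOpen_ball.mem_nhds hyx), self_mem_nhdsWithin]
      with t ht ht0
    refine ⟨ht, ?_⟩
    change 0 < η (y + t • u, (1 : ℝ))
    rw [hηu y hy]
    exact mul_pos ht0 hu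
  have hp : ∀ x ∈ F, ∃ p, p ∈ ball x (r x) ∩ {y | 0 < η (y, (1 : ℝ))} := fun x hx =>
    (hev x hx x hx (mem_ball_self (hr x hx))).exists.imp' _ fun _ h => h
  choose! p hp using hp
  have hcomp : ∀ x ∈ F, ball x (r x) ∩ {y | 0 < η (y, (1 : ℝ))} ⊆ connectedComponentIn X (p x) :=
    fun x hx => (hconv x).isPreconnected.subset_connectedComponentIn (hp x hx) (hrX x hx)
  have heq : ∀ x ∈ F, connectedComponentIn X (p x₀) = connectedComponentIn X (p x) := by
    intro x hx
    refine hFconv.isPreconnected.induction₂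
      (fun x y => connectedComponentIn X (p x) = connectedComponentIn X (p y)) ?_
      (fun _ _ _ _ _ _ h h' => h.trans h') (fun _ _ _ _ h => h.symm) hx₀ hx
    intro x hx
    filter_upwards [self_mem_nhdsWithin, nhdsWithin_le_nhds (ball_mem_nhds x (hr x hx))]
      with y hy hyx
    obtain ⟨t, h1, h2⟩ :=
      ((hev x hx y hy hyx).and (hev y hy y hy (mem_ball_self (hr y hy)))).exists
    rw [connectedComponentIn_eq (hcomp x hx h1), connectedComponentIn_eq (hcomp y hy h2)]
  refine ⟨p x₀, hrX x₀ hx₀ (hp x₀ hx₀), fun x hx => ?_⟩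
  refine mem_closure_of_tendsto (htu x) ?_
  filter_upwards [hev x hx x hx (mem_ball_self (hr x hx))] with t ht
  rw [heq x hx]
  exact hcomp x hx ht

theorem all_flats_boundary_finitely_many_orbits {d : ℕ} (Ω : Set (Euc d)) (hne : Ω.Nonempty)
    (hbd : Bornology.IsBounded Ω) (hop : IsOpen Ω) (hconv : Convex ℝ Ω)
    (hd : 3 ≤ d) (hirr : IsIrreducibleDomain Ω)
    (Γ : Subgroup ((Euc d × ℝ) ≃ₗ[ℝ] (Euc d × ℝ)))
    (htf : TorsionFreeSub Γ) (hdiv : Divides Ω Γ)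
    :
    (∀ F : Set (Euc d), IsFlat Ω F → IsBoundaryFlat Ω F) ∧
    ∃ (k : ℕ) (Fs : Fin k → Set (Euc d)),
      (∀ j, IsFlat Ω (Fs j)) ∧
      ∀ F : Set (Euc d), IsFlat Ω F →
        ∃ γ ∈ Γ, ∃ j : Fin k, F = projAct γ '' Fs j := by
  have hC := IsDivisibleCone.of_divides hne hbd hop hconv hirr hdiv
  exact ⟨fun F hF => hF.isBoundaryFlat hd hbd hop hC,
    exists_finite_orbit_representatives hd hbd hC hdiv⟩
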